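/- arXiv:2404.05756 — 4 statements merged into one kernel-verified Lean document; each statement's English description precedes it below -/
import Mathlib

section
/- The functions I(τ)⁴ and J(τ)⁴ are invariant under Γ₁(10), i.e. I(γτ)⁴ = I(τ)⁴ and J(γτ)⁴ = J(τ)⁴ for all γ ∈ Γ₁(10) and τ ∈ ℍ; moreover the functions τ ↦ I(4τ) and τ ↦ J(4τ) are invariant under Γ₁(40), i.e. I(4·γτ) = I(4τ) and J(4·γτ) = J(4τ) for all γ ∈ Γ₁(40) and τ ∈ ℍ. -/
open Complex

/-- The `q`-Pochhammer infinite product `(a; q)∞ = ∏_{n=0}^∞ (1 - a qⁿ)`. -/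
noncomputable def qPoch (a q : ℂ) : ℂ := ∏' n : ℕ, (1 - a * q ^ n)

/-- The nome `q = e^{2πiτ}` of a point `τ` of the upper half-plane. -/
noncomputable def Qc (τ : UpperHalfPlane) : ℂ := Complex.exp (2 * Real.pi * Complex.I * τ)


/-- `I(τ) = q^{3/4}(q;q¹⁰)∞(q⁹;q¹⁰)∞ / ((q⁴;q¹⁰)∞(q⁶;q¹⁰)∞)` with `q^{3/4} = e^{2πiτ·(3/4)}`. -/
noncomputable def Ifun (τ : UpperHalfPlane) : ℂ :=
  Complex.exp (2 * Real.pi * Complex.I * τ * (3 / 4)) *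
    (qPoch (Qc τ) (Qc τ ^ 10) * qPoch (Qc τ ^ 9) (Qc τ ^ 10)) /
    (qPoch (Qc τ ^ 4) (Qc τ ^ 10) * qPoch (Qc τ ^ 6) (Qc τ ^ 10))

/-- `J(τ) = q^{1/4}(q²;q¹⁰)∞(q⁸;q¹⁰)∞ / ((q³;q¹⁰)∞(q⁷;q¹⁰)∞)` with `q^{1/4} = e^{2πiτ·(1/4)}`. -/
noncomputable def Jfun (τ : UpperHalfPlane) : ℂ :=
  Complex.exp (2 * Real.pi * Complex.I * τ * (1 / 4)) *
    (qPoch (Qc τ ^ 2) (Qc τ ^ 10) * qPoch (Qc τ ^ 8) (Qc τ ^ 10)) /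
    (qPoch (Qc τ ^ 3) (Qc τ ^ 10) * qPoch (Qc τ ^ 7) (Qc τ ^ 10))

/-- The point `4τ` of the upper half-plane. -/
noncomputable def mul4 (τ : UpperHalfPlane) : UpperHalfPlane := ⟨4 * (τ : ℂ), by simpa using τ.2⟩


/-! ### The Jacobi triple product -/

/-- Finite products `(q;q)_n`. -/
noncomputable def jtpP (q : ℂ) (n : ℕ) : ℂ := ∏ k ∈ Finset.range n, (1 - q ^ (k + 1))

/-- The reciprocal of `(q;q)_m`, extended by zero to negative `m`. -/
noncomputable def jtpR (q : ℂ) (m : ℤ) : ℂ := if 0 ≤ m then (jtpP q m.toNat)⁻¹ else 0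

/-- Symmetric `q`-binomial coefficients. -/
noncomputable def jtpB (q : ℂ) (n : ℕ) (j : ℤ) : ℂ :=
  jtpP q (2 * n) * jtpR q (n - j) * jtpR q (n + j)

lemma jtp_one_sub_ne {q : ℂ} (hq : ‖q‖ < 1) (k : ℕ) : 1 - q ^ (k + 1) ≠ 0 := by
  intro h
  have h1 : q ^ (k + 1) = 1 := (sub_eq_zero.mp h).symm
  have h2 : ‖q‖ ^ (k + 1) = 1 := by rw [← norm_pow, h1, norm_one]
  have h3 : ‖q‖ ^ (k + 1) < 1 := pow_lt_one₀ (norm_nonneg _) hq (by omega)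
  linarith

lemma jtpP_ne {q : ℂ} (hq : ‖q‖ < 1) (n : ℕ) : jtpP q n ≠ 0 :=
  Finset.prod_ne_zero_iff.mpr fun k _ => jtp_one_sub_ne hq k

lemma jtpR_rec {q : ℂ} (hq : ‖q‖ < 1) (m : ℤ) : jtpR q (m - 1) = (1 - q ^ m) * jtpR q m := by
  rcases lt_trichotomy m 0 with h | h | h
  · simp [jtpR, show ¬ (0 ≤ m) by omega, show ¬ (1 ≤ m) by omega]
  · subst h; simp [jtpR]
  · obtain ⟨k, rfl⟩ : ∃ k : ℕ, m = (k : ℤ) + 1 := ⟨(m - 1).toNat, by omega⟩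
    have e1 : jtpR q ((k : ℤ) + 1 - 1) = (jtpP q k)⁻¹ := by simp [jtpR]
    have e2 : jtpR q ((k : ℤ) + 1) = (jtpP q (k + 1))⁻¹ := by
      have : (0 : ℤ) ≤ (k : ℤ) + 1 := by omega
      simp only [jtpR, this, if_true]
      congr 2
    have e3 : jtpP q (k + 1) = jtpP q k * (1 - q ^ (k + 1)) := Finset.prod_range_succ _ _
    have e4 : q ^ ((k : ℤ) + 1) = q ^ (k + 1) := by exact_mod_cast zpow_natCast q (k + 1)
    have := jtpP_ne hq k
    have := jtp_one_sub_ne hq k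
    rw [e1, e2, e3, e4]
    field_simp

lemma jtpB_rec {q : ℂ} (hq : ‖q‖ < 1) (hq0 : q ≠ 0) (n : ℕ) (j : ℤ) :
    jtpB q (n + 1) j = (1 + q ^ (2 * n + 1)) * jtpB q n j
      + q ^ ((n : ℤ) + 1 - j) * jtpB q n (j - 1) + q ^ ((n : ℤ) + 1 + j) * jtpB q n (j + 1) := by
  have e3 : jtpP q (2 * (n + 1)) = jtpP q (2 * n) * (1 - q ^ (2 * n + 1)) * (1 - q ^ (2 * n + 2)) := by
    rw [show 2 * (n + 1) = 2 * n + 1 + 1 by ring]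
    unfold jtpP
    rw [Finset.prod_range_succ, Finset.prod_range_succ]
  have a1 : jtpR q ((n : ℤ) - j) = (1 - q ^ ((n : ℤ) + 1 - j)) * jtpR q ((n : ℤ) + 1 - j) := by
    rw [← jtpR_rec hq]; congr 1; ring
  have a2 : jtpR q ((n : ℤ) + j) = (1 - q ^ ((n : ℤ) + 1 + j)) * jtpR q ((n : ℤ) + 1 + j) := by
    rw [← jtpR_rec hq]; congr 1; ring
  have a3 : jtpR q ((n : ℤ) - (j + 1)) = (1 - q ^ ((n : ℤ) + 1 - j) / q) *
      jtpR q ((n : ℤ) - j) := by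
    rw [div_eq_mul_inv, ← zpow_sub_one₀ hq0, show (n : ℤ) + 1 - j - 1 = n - j by ring, ← jtpR_rec hq]
    congr 1; ring
  have a4 : jtpR q ((n : ℤ) + (j - 1)) = (1 - q ^ ((n : ℤ) + 1 + j) / q) *
      jtpR q ((n : ℤ) + j) := by
    rw [div_eq_mul_inv, ← zpow_sub_one₀ hq0, show (n : ℤ) + 1 + j - 1 = n + j by ring, ← jtpR_rec hq]
    congr 1; ring
  have a5 : jtpR q ((n : ℤ) - (j - 1)) = jtpR q ((n : ℤ) + 1 - j) := by congr 1; ring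
  have a6 : jtpR q ((n : ℤ) + (j + 1)) = jtpR q ((n : ℤ) + 1 + j) := by congr 1; ring
  have hAB : q ^ (2 * n + 2) = q ^ ((n : ℤ) + 1 - j) * q ^ ((n : ℤ) + 1 + j) := by
    rw [← zpow_add₀ hq0, ← zpow_natCast]; congr 1; push_cast; ring
  have hAB' : q ^ (2 * n + 1) = q ^ ((n : ℤ) + 1 - j) * q ^ ((n : ℤ) + 1 + j) / q := by
    rw [← hAB, pow_succ _ (2 * n + 1)]; field_simp
  unfold jtpB
  rw [e3, a3, a4, a5, a6, a1, a2, hAB, hAB']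
  push_cast
  generalize q ^ ((n : ℤ) + 1 - j) = A
  generalize q ^ ((n : ℤ) + 1 + j) = B
  field_simp
  ring

lemma hasSum_congr_both {f g : ℤ → ℂ} {a b : ℂ} (hf : f = g) (ha : a = b) :
    HasSum f a ↔ HasSum g b := by rw [hf, ha]

lemma jtp_finite {q x : ℂ} (hq : ‖q‖ < 1) (hq0 : q ≠ 0) (hx : x ≠ 0) (t : ℤ → ℂ) (t0 : t 0 = 1)
    (ht : ∀ j, t (j + 1) = - x * q ^ (j + 1) * t j) (n : ℕ) :
    HasSum (fun j : ℤ => t j * jtpB q n j)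
      (∏ k ∈ Finset.range n, ((1 - x * q ^ (k + 1)) * (1 - x⁻¹ * q ^ k))) := by
  induction n with
  | zero =>
    have : ∀ j : ℤ, j ≠ 0 → t j * jtpB q 0 j = 0 := by
      intro j hj
      rcases lt_or_gt_of_ne hj with h | h
      · simp [jtpB, jtpR, show ¬ (0 ≤ j) by omega]
      · simp [jtpB, jtpR, show ¬ (j ≤ 0) by omega]
    have h := hasSum_single (f := fun j : ℤ => t j * jtpB q 0 j) 0 this
    simpa [t0, jtpB, jtpR, jtpP] using h
  | succ n ih =>
    have h1 := (Equiv.addRight (1 : ℤ)).hasSum_iff.mpr ih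
    have h2 := (Equiv.subRight (1 : ℤ)).hasSum_iff.mpr ih
    have h := ((ih.mul_left (1 + q ^ (2 * n + 1))).add (h2.mul_left (-x * q ^ (n + 1)))).add
      (h1.mul_left (-x⁻¹ * q ^ n))
    suffices hfv : _ ∧ _ from (hasSum_congr_both hfv.1 hfv.2).mpr h
    constructor
    · funext j
      simp only [Function.comp, Equiv.coe_addRight, Equiv.subRight_apply]
      rw [jtpB_rec hq hq0]
      have e1 : t j = -x * q ^ j * t (j - 1) := by
        have := ht (j - 1); simpa using this
      have e2 : q ^ ((n : ℤ) + 1 - j) * q ^ j = q ^ (n + 1) := by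
        rw [← zpow_add₀ hq0, ← zpow_natCast]; congr 1; push_cast; ring
      have e3 : q ^ ((n : ℤ) + 1 + j) = q ^ n * q ^ (j + 1) := by
        rw [← zpow_natCast, ← zpow_add₀ hq0]; congr 1; ring
      have e4 : t j * (q ^ ((n : ℤ) + 1 - j) * jtpB q n (j - 1)) =
          -x * q ^ (n + 1) * (t (j - 1) * jtpB q n (j - 1)) := by
        rw [e1, ← e2]; ring
      have e5 : t j * (q ^ ((n : ℤ) + 1 + j) * jtpB q n (j + 1)) =
          -x⁻¹ * q ^ n * (t (j + 1) * jtpB q n (j + 1)) := by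
        rw [ht j, e3]; field_simp
      rw [mul_add, mul_add, e4, e5]; ring
    · rw [Finset.prod_range_succ]
      field_simp
      ring

open Filter Topology in
lemma jtp_main {q x : ℂ} (hq : ‖q‖ < 1) (hq0 : q ≠ 0) (hx : x ≠ 0) (t : ℤ → ℂ) (t0 : t 0 = 1)
    (ht : ∀ j, t (j + 1) = - x * q ^ (j + 1) * t j) (hs : Summable t) :
    ∃ K : ℂ, K ≠ 0 ∧ K = ∏' n : ℕ, (1 - q ^ (n + 1)) ∧ ∑' j, t j =
      K * ((∏' k : ℕ, (1 - x * q ^ (k + 1))) * (∏' k : ℕ, (1 - x⁻¹ * q ^ k))) := by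
  have hgeo : Summable fun n : ℕ => ‖q‖ ^ n := summable_geometric_of_lt_one (norm_nonneg _) hq
  have m1 : Multipliable fun n : ℕ => (1 - q ^ (n + 1)) := ModularForm.multipliable_one_sub_pow hq
  have m2 : ∀ y : ℂ, Multipliable fun n : ℕ => (1 - y * q ^ n) := fun y => by
    simp_rw [sub_eq_add_neg]
    apply multipliable_one_add_of_summable
    simpa [norm_mul] using hgeo.mul_left ‖y‖
  have m3 : Multipliable fun n : ℕ => (1 - x * q ^ (n + 1)) := by
    simpa [pow_succ', mul_assoc] using m2 (x * q)
  set K := ∏' n : ℕ, (1 - q ^ (n + 1)) with hK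
  have hK0 : K ≠ 0 := by
    have := tprod_one_add_ne_zero_of_summable (f := fun n : ℕ => -q ^ (n + 1))
      (fun i => by simpa [sub_eq_add_neg] using jtp_one_sub_ne hq i)
      (by simpa using (summable_nat_add_iff 1).mpr hgeo)
    simpa [hK, sub_eq_add_neg] using this
  have tP : Tendsto (jtpP q) atTop (𝓝 K) := m1.hasProd.tendsto_prod_nat
  have tPi : Tendsto (fun n => (jtpP q n)⁻¹) atTop (𝓝 K⁻¹) := tP.inv₀ hK0
  have tR : Tendsto (jtpR q) atTop (𝓝 K⁻¹) := by
    have h1 : Tendsto Int.toNat atTop atTop :=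
      tendsto_atTop_atTop.mpr fun b => ⟨b, fun a ha => by omega⟩
    refine (tPi.comp h1).congr' ?_
    filter_upwards [eventually_ge_atTop (0 : ℤ)] with m hm
    simp [jtpR, hm]
  obtain ⟨M1, hM1⟩ := (Metric.isBounded_range_of_tendsto _ tP).exists_norm_le
  obtain ⟨M2, hM2⟩ := (Metric.isBounded_range_of_tendsto _ tPi).exists_norm_le
  have b1 : ∀ n, ‖jtpP q n‖ ≤ M1 := fun n => hM1 _ ⟨n, rfl⟩
  have b2 : ∀ m, ‖jtpR q m‖ ≤ M2 := fun m => by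
    unfold jtpR
    split_ifs
    · exact hM2 _ ⟨_, rfl⟩
    · simpa using (norm_nonneg _).trans (hM2 _ ⟨0, rfl⟩)
  have hM1' : 0 ≤ M1 := (norm_nonneg _).trans (b1 0)
  have hM2' : 0 ≤ M2 := (norm_nonneg _).trans (b2 0)
  have b3 : ∀ n j, ‖jtpB q n j‖ ≤ M1 * M2 * M2 := fun n j => by
    unfold jtpB
    rw [norm_mul, norm_mul]
    gcongr
    · exact b1 _
    · exact b2 _
    · exact b2 _
  have tB : ∀ j, Tendsto (fun n => jtpB q n j) atTop (𝓝 K⁻¹) := fun j => by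
    have c0 : Tendsto (fun n : ℕ => (n : ℤ)) atTop atTop := tendsto_natCast_atTop_atTop
    have c1 := tP.comp (tendsto_id.const_mul_atTop' (show 0 < 2 by norm_num))
    have c2 := tR.comp (tendsto_atTop_add_const_right _ (-j) c0)
    have c3 := tR.comp (tendsto_atTop_add_const_right _ j c0)
    have := (c1.mul c2).mul c3
    rw [mul_inv_cancel₀ hK0, one_mul] at this
    simpa [jtpB, Function.comp_def, sub_eq_add_neg] using this
  have lim1 := tendsto_tsum_of_dominated_convergence (𝓕 := atTop)
    (f := fun n j => t j * jtpB q n j) (g := fun j => t j * K⁻¹)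
    (bound := fun j => ‖t j‖ * (M1 * M2 * M2)) (hs.norm.mul_right _)
    (fun j => (tB j).const_mul _)
    (Eventually.of_forall fun n j => by rw [norm_mul]; gcongr; exact b3 n j)
  have lim2 := m3.hasProd.tendsto_prod_nat.mul (m2 x⁻¹).hasProd.tendsto_prod_nat
  simp_rw [fun n => (jtp_finite hq hq0 hx t t0 ht n).tsum_eq, Finset.prod_mul_distrib] at lim1
  have := tendsto_nhds_unique lim1 lim2
  refine ⟨K, hK0, rfl, ?_⟩
  rw [← this, tsum_mul_right]
  field_simp

/-! ### The odd theta function and its modular transformation -/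

/-- The odd Jacobi theta function (up to a factor depending only on `τ`). -/
noncomputable def oTh (z τ : ℂ) : ℂ :=
  cexp (Real.pi * I * z) * jacobiTheta₂ (z + (τ + 1) / 2) τ

lemma jacobiTheta₂_shift (z τ : ℂ) (m n : ℤ) : jacobiTheta₂ (z + m * τ + n) τ =
    cexp (-Real.pi * I * (m ^ 2 * τ + 2 * m * z)) * jacobiTheta₂ z τ := by
  conv_rhs => rw [jacobiTheta₂, ← tsum_mul_left, ← (Equiv.addRight m).tsum_eq]
  refine tsum_congr (fun k ↦ ?_)
  simp_rw [jacobiTheta₂_term, ← Complex.exp_add, Equiv.coe_addRight]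
  rw [Complex.exp_eq_exp_iff_exists_int]
  refine ⟨k * n, ?_⟩
  push_cast
  ring

lemma oTh_shift (z τ : ℂ) (m n : ℤ) : oTh (z + m * τ + n) τ =
    cexp (Real.pi * I * (n + m - m ^ 2 * τ - 2 * m * z)) * oTh z τ := by
  unfold oTh
  have := jacobiTheta₂_shift (z + (τ + 1) / 2) τ m n
  rw [show z + m * τ + n + (τ + 1) / 2 = z + (τ + 1) / 2 + m * τ + n by ring, this,
    ← mul_assoc, ← mul_assoc, ← Complex.exp_add, ← Complex.exp_add]
  congr 1
  rw [Complex.exp_eq_exp_iff_exists_int]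
  refine ⟨-m, ?_⟩
  push_cast
  ring

lemma oTh_T (z τ : ℂ) : oTh z (τ + 1) = oTh z τ := by
  unfold oTh
  congr 1
  refine tsum_congr (fun k ↦ ?_)
  simp_rw [jacobiTheta₂_term]
  rw [Complex.exp_eq_exp_iff_exists_int]
  obtain ⟨r, hr⟩ := Int.even_mul_succ_self k
  refine ⟨r, ?_⟩
  have hr' : (k : ℂ) * (k + 1) = r + r := by exact_mod_cast hr
  linear_combination (Real.pi * I) * hr'

lemma oTh_S (z : ℂ) (τ : UpperHalfPlane) : oTh (z / τ) (-1 / τ) =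
    ((-I * τ) ^ (1 / 2 : ℂ) * cexp (Real.pi * I * ((τ - 1) ^ 2 / (4 * τ)))) *
      cexp (Real.pi * I * z ^ 2 / τ) * oTh z τ := by
  have h0 : (τ : ℂ) ≠ 0 := UpperHalfPlane.ne_zero τ
  have hc : (-I * (τ : ℂ)) ^ (1 / 2 : ℂ) ≠ 0 := by
    rw [Complex.cpow_ne_zero_iff]; left; simp [h0]
  have h := jacobiTheta₂_functional_equation (z + (τ - 1) / 2) τ
  have h1 : jacobiTheta₂ (z + (τ + 1) / 2) τ = jacobiTheta₂ (z + (τ - 1) / 2) τ := by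
    rw [← jacobiTheta₂_add_left (z + (τ - 1) / 2)]; congr 1; ring
  unfold oTh
  rw [h1, h, show (z + ((τ : ℂ) - 1) / 2) / τ = z / τ + (-1 / τ + 1) / 2 by field_simp; ring]
  generalize jacobiTheta₂ (z / τ + (-1 / τ + 1) / 2) (-1 / τ) = X
  generalize (-I * (τ : ℂ)) ^ (1 / 2 : ℂ) = c at *
  have e : cexp (Real.pi * I * (z / τ)) = cexp (Real.pi * I * ((τ - 1) ^ 2 / (4 * τ))) *
      cexp (Real.pi * I * z ^ 2 / τ) * cexp (Real.pi * I * z) *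
      cexp (-Real.pi * I * (z + (τ - 1) / 2) ^ 2 / τ) := by
    simp_rw [← Complex.exp_add]
    congr 1
    field_simp
    ring
  rw [e]
  field_simp

open UpperHalfPlane in
lemma sl_denom_ne (γ : Matrix.SpecialLinearGroup (Fin 2) ℤ) (τ : UpperHalfPlane) :
    ((γ 1 0 : ℤ) : ℂ) * τ + (γ 1 1 : ℤ) ≠ 0 := by
  have := UpperHalfPlane.denom_ne_zero (γ : Matrix.GeneralLinearGroup (Fin 2) ℝ) τ
  rw [ModularGroup.denom_apply] at this
  exact this

lemma sl_coe (γ : Matrix.SpecialLinearGroup (Fin 2) ℤ) (τ : UpperHalfPlane) :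
    ((γ • τ : UpperHalfPlane) : ℂ) =
      (((γ 0 0 : ℤ) : ℂ) * τ + (γ 0 1 : ℤ)) / (((γ 1 0 : ℤ) : ℂ) * τ + (γ 1 1 : ℤ)) := by
  rw [UpperHalfPlane.coe_specialLinearGroup_apply]
  simp

lemma sl_det (γ : Matrix.SpecialLinearGroup (Fin 2) ℤ) :
    ((γ 0 0 : ℤ) : ℂ) * (γ 1 1 : ℤ) - (γ 0 1 : ℤ) * (γ 1 0 : ℤ) = 1 := by
  have := γ.det_coe
  rw [Matrix.det_fin_two] at this
  exact_mod_cast this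

/-- Modular transformation of the odd theta function, with an unspecified multiplier. -/
def oThTr (γ : Matrix.SpecialLinearGroup (Fin 2) ℤ) : Prop :=
  ∀ τ : UpperHalfPlane, ∃ C : ℂ, C ≠ 0 ∧ ∀ z : ℂ,
    oTh (z / (((γ 1 0 : ℤ) : ℂ) * τ + (γ 1 1 : ℤ))) ((γ • τ : UpperHalfPlane) : ℂ) =
      C * cexp (Real.pi * I * ((γ 1 0 : ℤ) * z ^ 2 / (((γ 1 0 : ℤ) : ℂ) * τ + (γ 1 1 : ℤ)))) *
        oTh z τ

lemma oThTr_one : oThTr 1 := fun τ => ⟨1, one_ne_zero, fun z => by simp⟩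

lemma oThTr_S : oThTr ModularGroup.S := by
  intro τ
  have h0 : (τ : ℂ) ≠ 0 := UpperHalfPlane.ne_zero τ
  refine ⟨(-I * τ) ^ (1 / 2 : ℂ) * cexp (Real.pi * I * ((τ - 1) ^ 2 / (4 * τ))), ?_, fun z => ?_⟩
  · refine mul_ne_zero ?_ (Complex.exp_ne_zero _)
    rw [Complex.cpow_ne_zero_iff]; left; simp [h0]
  · rw [sl_coe]
    have := oTh_S z τ
    simpa [ModularGroup.S, mul_div_assoc] using this

lemma oThTr_T : oThTr ModularGroup.T := by
  intro τ
  refine ⟨1, one_ne_zero, fun z => ?_⟩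
  rw [sl_coe]
  simpa [ModularGroup.T] using oTh_T z τ

lemma oThTr_mul (g h : Matrix.SpecialLinearGroup (Fin 2) ℤ) (hg : oThTr g) (hh : oThTr h) :
    oThTr (g * h) := by
  intro τ
  obtain ⟨C1, hC1, H1⟩ := hg (h • τ)
  obtain ⟨C2, hC2, H2⟩ := hh τ
  refine ⟨C1 * C2, mul_ne_zero hC1 hC2, fun z => ?_⟩
  have d1 := sl_denom_ne h τ
  have d2 := sl_denom_ne g (h • τ)
  have d3 := sl_denom_ne (g * h) τ
  have e1 := H1 (z / (((h 1 0 : ℤ) : ℂ) * τ + (h 1 1 : ℤ)))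
  have hd := sl_det h
  rw [H2 z] at e1
  have c0 : (((g * h) 1 0 : ℤ) : ℂ) = (g 1 0 : ℤ) * (h 0 0 : ℤ) + (g 1 1 : ℤ) * (h 1 0 : ℤ) := by
    simp [Matrix.mul_apply, Fin.sum_univ_two]
  have c1 : (((g * h) 1 1 : ℤ) : ℂ) = (g 1 0 : ℤ) * (h 0 1 : ℤ) + (g 1 1 : ℤ) * (h 1 1 : ℤ) := by
    simp [Matrix.mul_apply, Fin.sum_univ_two]
  rw [sl_coe h] at e1 d2
  rw [SemigroupAction.mul_smul]
  rw [c0, c1] at d3 ⊢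
  generalize ((g 1 0 : ℤ) : ℂ) = gc at *
  generalize ((g 1 1 : ℤ) : ℂ) = gd at *
  generalize ((h 0 0 : ℤ) : ℂ) = a at *
  generalize ((h 0 1 : ℤ) : ℂ) = b at *
  generalize ((h 1 0 : ℤ) : ℂ) = c at *
  generalize ((h 1 1 : ℤ) : ℂ) = d at *
  have k1 : (c * τ + d) * (gc * ((a * τ + b) / (c * τ + d)) + gd) =
    (gc * a + gd * c) * τ + (gc * b + gd * d) := by field_simp; ring
  rw [div_div, k1] at e1
  rw [e1]
  rw [show ∀ x y u v w : ℂ, x * y * (u * v * w) = x * u * (y * v) * w by intros; ring,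
    ← Complex.exp_add]
  congr 3
  have k2 : gc * ((a * τ + b) / (c * τ + d)) + gd =
    ((gc * a + gd * c) * τ + (gc * b + gd * d)) / (c * τ + d) := by
    rw [← k1, mul_div_cancel_left₀ _ d1]
  rw [k2, ← mul_add]
  congr 1
  have key : gc + c * ((gc * a + gd * c) * τ + (gc * b + gd * d)) =
      (gc * a + gd * c) * (c * τ + d) := by linear_combination (-gc : ℂ) * hd
  clear k1 k2 e1 d2 H1 H2
  generalize (gc * a + gd * c) * (τ : ℂ) + (gc * b + gd * d) = N at *
  generalize c * (τ : ℂ) + d = M at *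
  field_simp
  linear_combination z ^ 2 * key

lemma oThTr_inv (g : Matrix.SpecialLinearGroup (Fin 2) ℤ) (hg : oThTr g) : oThTr g⁻¹ := by
  intro τ
  obtain ⟨C, hC, H⟩ := hg (g⁻¹ • τ)
  refine ⟨C⁻¹, inv_ne_zero hC, fun z => ?_⟩
  have d1 := sl_denom_ne g⁻¹ τ
  have d2 := sl_denom_ne g (g⁻¹ • τ)
  have hd := sl_det g
  have e1 := H (z / (((g⁻¹ 1 0 : ℤ) : ℂ) * τ + (g⁻¹ 1 1 : ℤ)))
  have c0 : ((g⁻¹ 0 0 : ℤ) : ℂ) = (g 1 1 : ℤ) := by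
    simp [Matrix.SpecialLinearGroup.SL2_inv_expl]
  have c1 : ((g⁻¹ 0 1 : ℤ) : ℂ) = -(g 0 1 : ℤ) := by
    simp [Matrix.SpecialLinearGroup.SL2_inv_expl]
  have c2 : ((g⁻¹ 1 0 : ℤ) : ℂ) = -(g 1 0 : ℤ) := by
    simp [Matrix.SpecialLinearGroup.SL2_inv_expl]
  have c3 : ((g⁻¹ 1 1 : ℤ) : ℂ) = (g 0 0 : ℤ) := by
    simp [Matrix.SpecialLinearGroup.SL2_inv_expl]
  rw [smul_inv_smul] at e1
  have k1 : ((g 1 0 : ℤ) : ℂ) * ((g⁻¹ • τ : UpperHalfPlane) : ℂ) + (g 1 1 : ℤ) =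
      (((g⁻¹ 1 0 : ℤ) : ℂ) * τ + (g⁻¹ 1 1 : ℤ))⁻¹ := by
    rw [sl_coe g⁻¹, mul_div_assoc', div_add' _ _ _ d1,
      ← one_div (_ + ((g⁻¹ 1 1 : ℤ) : ℂ))]
    congr 1
    rw [c0, c1, c2, c3]
    linear_combination hd
  rw [k1, div_inv_eq_mul, div_mul_cancel₀ _ d1] at e1
  rw [e1]
  rw [show ∀ x y u v w : ℂ, x * y * (u * v * w) = (x * u) * (y * v) * w by intros; ring,
    inv_mul_cancel₀ hC, ← Complex.exp_add]
  conv_lhs => rw [← one_mul (oTh _ _)]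
  congr 1
  rw [one_mul, eq_comm, c2, Complex.exp_eq_one_iff]
  refine ⟨0, ?_⟩
  rw [c2] at d1
  field_simp
  ring

lemma oThTr_all (γ : Matrix.SpecialLinearGroup (Fin 2) ℤ) : oThTr γ := by
  have : γ ∈ Subgroup.closure {ModularGroup.S, ModularGroup.T} := by
    simp [SpecialLinearGroup.SL2Z_generators]
  induction this using Subgroup.closure_induction with
  | one => exact oThTr_one
  | mem g hg =>
    rcases hg with rfl | rfl
    · exact oThTr_S
    · exact oThTr_T
  | mul g h _ _ ig ih => exact oThTr_mul g h ig ih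
  | inv g _ ig => exact oThTr_inv g ig

/-! ### Generalized eta quotients of level ten -/

/-- The point `10τ` of the upper half-plane. -/
noncomputable def mul10 (τ : UpperHalfPlane) : UpperHalfPlane := ⟨10 * (τ : ℂ), by simpa using τ.2⟩

/-- Generalized eta functions of level ten, up to a factor independent of `g`. -/
noncomputable def gEta (g : ℕ) (τ : UpperHalfPlane) : ℂ :=
  cexp (Real.pi * I * (g ^ 2 * τ / 10)) * oTh (-(g * τ)) (10 * τ)

lemma gEta_transform (a b c d k : ℤ) (hdet : a * d - (10 * b) * c = 1) (ha : a = 1 + 10 * k)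
    (τ σ : UpperHalfPlane) (hσ : (σ : ℂ) = (a * τ + b) / (10 * c * τ + d)) :
    ∃ D : ℂ, D ≠ 0 ∧ ∀ g : ℕ, gEta g σ =
      D * cexp (Real.pi * I * (g ^ 2 * (a * b) / 10 - g * (k + b))) * gEta g τ := by
  let γ : Matrix.SpecialLinearGroup (Fin 2) ℤ :=
    ⟨!![a, 10 * b; c, d], by rw [Matrix.det_fin_two]; simpa using hdet⟩
  have g00 : γ 0 0 = a := rfl
  have g01 : γ 0 1 = 10 * b := rfl
  have g10 : γ 1 0 = c := rfl
  have g11 : γ 1 1 = d := rfl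
  have hj : (c : ℂ) * (10 * τ) + d ≠ 0 := by
    have := sl_denom_ne γ (mul10 τ)
    rwa [g10, g11] at this
  obtain ⟨C, hC, H⟩ := oThTr_all γ (mul10 τ)
  have hs := sl_coe γ (mul10 τ)
  rw [hs, g00, g01, g10, g11] at H
  have hm : ((mul10 τ : UpperHalfPlane) : ℂ) = 10 * τ := rfl
  rw [hm] at H
  refine ⟨C, hC, fun g => ?_⟩
  have h1 := H (-(g * (a * τ + b)))
  have hd' : (a : ℂ) * d - 10 * b * c = 1 := by exact_mod_cast hdet
  have ha' : (a : ℂ) = 1 + 10 * k := by exact_mod_cast ha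
  have e1 : (a * (10 * (τ : ℂ)) + ((10 * b : ℤ) : ℂ)) / (c * (10 * τ) + d) = 10 * σ := by
    rw [hσ, show 10 * (c : ℂ) * τ + d = c * (10 * τ) + d by ring, mul_div_assoc']
    congr 1; push_cast; ring
  have e2 : -((g : ℂ) * (a * τ + b)) / (c * (10 * τ) + d) = -(g * σ) := by
    rw [hσ, show 10 * (c : ℂ) * τ + d = c * (10 * τ) + d by ring, mul_div_assoc', neg_div]
  have e3 : -((g : ℂ) * (a * τ + b)) = -(g * τ) + ((-(g * k) : ℤ) : ℂ) * (10 * τ) +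
      ((-(g * b) : ℤ) : ℂ) := by
    rw [ha']; push_cast; ring
  rw [e1, e2] at h1
  unfold gEta
  rw [h1]
  conv_lhs => rw [e3]
  rw [oTh_shift, show ∀ x u y v w : ℂ, x * (u * y * (v * w)) = u * (x * y * v) * w by intros; ring,
    ← Complex.exp_add, ← Complex.exp_add, mul_assoc C, mul_assoc C, ← mul_assoc (cexp _),
    ← Complex.exp_add]
  congr 3
  rw [← mul_add, ← mul_add, ← mul_add, ← e3]
  congr 1
  rw [hσ, show 10 * (c : ℂ) * τ + d = c * (10 * τ) + d by ring]
  have key : ((a : ℂ) * τ + b) * (1 + 10 * c * (a * τ + b)) =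
      a * (a * τ + b) * ((c : ℂ) * (10 * τ) + d) := by
    linear_combination (-(a * (τ : ℂ) + b)) * hd'
  have key2 : (g : ℂ) ^ 2 * ((a * τ + b) / (c * (10 * τ) + d)) / 10 +
      c * (-(g * (a * τ + b))) ^ 2 / (c * (10 * τ) + d) = g ^ 2 * (a * (a * τ + b)) / 10 := by
    generalize (c : ℂ) * (10 * τ) + d = M at *
    field_simp
    linear_combination g ^ 2 * key
  rw [key2, ha']
  push_cast
  ring

lemma Qc_pow (τ : UpperHalfPlane) (n : ℕ) : Qc τ ^ n = cexp (2 * Real.pi * I * (n * τ)) := by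
  rw [Qc, ← Complex.exp_nat_mul]; congr 1; ring

lemma gEta_prod (τ : UpperHalfPlane) : ∃ L : ℂ, L ≠ 0 ∧ ∀ g : ℕ, g ≤ 10 → gEta g τ =
    L * (cexp (Real.pi * I * (g ^ 2 * τ / 10 - g * τ)) *
      (qPoch (Qc τ ^ g) (Qc τ ^ 10) * qPoch (Qc τ ^ (10 - g)) (Qc τ ^ 10))) := by
  have hQ : ‖Qc τ‖ < 1 := by
    simpa [Qc] using UpperHalfPlane.norm_exp_two_pi_I_lt_one τ
  have hQ0 : Qc τ ≠ 0 := Complex.exp_ne_zero _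
  have hq : ‖Qc τ ^ 10‖ < 1 := by
    rw [norm_pow]; exact pow_lt_one₀ (norm_nonneg _) hQ (by norm_num)
  have hq0 : Qc τ ^ 10 ≠ 0 := pow_ne_zero _ hQ0
  have him : 0 < (10 * (τ : ℂ)).im := (mul10 τ).2
  have main : ∀ g : ℕ, g ≤ 10 → ∃ K : ℂ, K ≠ 0 ∧ K = ∏' n : ℕ, (1 - (Qc τ ^ 10) ^ (n + 1)) ∧
      jacobiTheta₂ (-(g * τ) + (10 * τ + 1) / 2) (10 * τ) =
      K * (qPoch (Qc τ ^ (10 - g)) (Qc τ ^ 10) * qPoch (Qc τ ^ g) (Qc τ ^ 10)) := by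
    intro g hg
    have hx : (Qc τ ^ g)⁻¹ ≠ 0 := inv_ne_zero (pow_ne_zero _ hQ0)
    have := jtp_main hq hq0 hx
      (fun j => jacobiTheta₂_term j (-(g * τ) + (10 * τ + 1) / 2) (10 * τ))
      (by simp [jacobiTheta₂_term]) ?_ ?_
    · obtain ⟨K, h1, h2, h3⟩ := this
      refine ⟨K, h1, h2, ?_⟩
      rw [jacobiTheta₂, h3, inv_inv]
      congr 2
      unfold qPoch
      refine tprod_congr fun k => ?_
      have : Qc τ ^ 10 = Qc τ ^ (10 - g) * Qc τ ^ g := by rw [← pow_add]; congr 1; omega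
      have h4 := pow_ne_zero g hQ0
      congr 1
      rw [pow_succ]
      conv_lhs => rw [mul_comm (_ ^ k), ← mul_assoc]
      congr 1
      rw [this]
      field_simp
    · intro j
      rw [Qc_pow, Qc_pow, ← Complex.exp_neg, ← Complex.exp_int_mul]
      simp only [jacobiTheta₂_term]
      rw [show ∀ u v w : ℂ, -u * v * w = cexp (Real.pi * I) * (u * v * w) by
        intros; rw [Complex.exp_pi_mul_I]; ring, ← Complex.exp_add,
        ← Complex.exp_add, ← Complex.exp_add]
      congr 1
      push_cast
      ring
    · exact (summable_jacobiTheta₂_term_iff _ _).mpr him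
  obtain ⟨K, hK, hK', -⟩ := main 0 (by norm_num)
  refine ⟨K, hK, fun g hg => ?_⟩
  obtain ⟨K2, -, h2, h3⟩ := main g hg
  rw [← hK'] at h2
  subst h2
  unfold gEta oTh
  rw [h3, ← mul_assoc, ← Complex.exp_add,
    show Real.pi * I * ((g : ℂ) ^ 2 * τ / 10) + Real.pi * I * -(g * τ) =
      Real.pi * I * (g ^ 2 * τ / 10 - g * τ) by ring]
  ring

lemma Ifun_eq (τ : UpperHalfPlane) : Ifun τ = gEta 1 τ / gEta 4 τ := by
  obtain ⟨L, hL, h⟩ := gEta_prod τ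
  rw [h 1 (by norm_num), h 4 (by norm_num), mul_div_mul_left _ _ hL, mul_div_mul_comm,
    ← Complex.exp_sub, Ifun, mul_div_assoc]
  congr 2
  · push_cast; ring
  · simp

lemma Jfun_eq (τ : UpperHalfPlane) : Jfun τ = gEta 2 τ / gEta 3 τ := by
  obtain ⟨L, hL, h⟩ := gEta_prod τ
  rw [h 2 (by norm_num), h 3 (by norm_num), mul_div_mul_left _ _ hL, mul_div_mul_comm,
    ← Complex.exp_sub, Jfun, mul_div_assoc]
  congr 2
  push_cast; ring

lemma IJ_transform (a b c d k : ℤ) (hdet : a * d - (10 * b) * c = 1) (ha : a = 1 + 10 * k)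
    (τ σ : UpperHalfPlane) (hσ : (σ : ℂ) = (a * τ + b) / (10 * c * τ + d)) :
    Ifun σ = cexp (Real.pi * I * (-(3 * (a * b) / 2) + 3 * (k + b))) * Ifun τ ∧
    Jfun σ = cexp (Real.pi * I * (-((a * b) / 2) + (k + b))) * Jfun τ := by
  obtain ⟨D, hD, h⟩ := gEta_transform a b c d k hdet ha τ σ hσ
  rw [Ifun_eq, Ifun_eq, Jfun_eq, Jfun_eq, h 1, h 2, h 3, h 4]
  simp_rw [mul_assoc D, mul_div_mul_left _ _ hD, mul_div_mul_comm, ← Complex.exp_sub]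
  constructor
  · congr 2; push_cast; ring
  · congr 2; push_cast; ring

/-- `I(τ)⁴` and `J(τ)⁴` are invariant under `Γ₁(10)`, and `τ ↦ I(4τ)`, `τ ↦ J(4τ)` are
invariant under `Γ₁(40)`. -/
theorem statement4 :
    (∀ γ : CongruenceSubgroup.Gamma1 10, ∀ τ : UpperHalfPlane,
        Ifun ((γ : Matrix.SpecialLinearGroup (Fin 2) ℤ) • τ) ^ 4 = Ifun τ ^ 4 ∧
        Jfun ((γ : Matrix.SpecialLinearGroup (Fin 2) ℤ) • τ) ^ 4 = Jfun τ ^ 4) ∧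
    (∀ γ : CongruenceSubgroup.Gamma1 40, ∀ τ : UpperHalfPlane,
        Ifun (mul4 ((γ : Matrix.SpecialLinearGroup (Fin 2) ℤ) • τ)) = Ifun (mul4 τ) ∧
        Jfun (mul4 ((γ : Matrix.SpecialLinearGroup (Fin 2) ℤ) • τ)) = Jfun (mul4 τ)) := by
  constructor
  · rintro ⟨γ, hγ⟩ τ
    simp only
    obtain ⟨h1, -, h3⟩ := (CongruenceSubgroup.Gamma1_mem 10 γ).mp hγ
    obtain ⟨c, hc⟩ := (ZMod.intCast_zmod_eq_zero_iff_dvd _ 10).mp h3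
    obtain ⟨k, hk⟩ := (ZMod.intCast_zmod_eq_zero_iff_dvd (γ 0 0 - 1) 10).mp (by push_cast; simp [h1])
    have hdet := γ.det_coe
    rw [Matrix.det_fin_two] at hdet
    push_cast at hc hk
    obtain ⟨hI, hJ⟩ := IJ_transform (γ 0 0) (γ 0 1) c (γ 1 1) k
      (by rw [hc] at hdet; linear_combination hdet) (by linear_combination hk) τ (γ • τ)
      (by rw [sl_coe, hc]; push_cast; rfl)
    rw [hI, hJ, mul_pow, mul_pow, ← Complex.exp_nat_mul, ← Complex.exp_nat_mul]
    constructor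
    · rw [Complex.exp_eq_one_iff.mpr, one_mul]
      exact ⟨-(3 * (γ 0 0 * γ 0 1)) + 6 * (k + γ 0 1), by push_cast; ring⟩
    · rw [Complex.exp_eq_one_iff.mpr, one_mul]
      exact ⟨-((γ 0 0 * γ 0 1)) + 2 * (k + γ 0 1), by push_cast; ring⟩
  · rintro ⟨γ, hγ⟩ τ
    simp only
    obtain ⟨h1, -, h3⟩ := (CongruenceSubgroup.Gamma1_mem 40 γ).mp hγ
    obtain ⟨c, hc⟩ := (ZMod.intCast_zmod_eq_zero_iff_dvd _ 40).mp h3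
    obtain ⟨k, hk⟩ := (ZMod.intCast_zmod_eq_zero_iff_dvd (γ 0 0 - 1) 40).mp (by push_cast; simp [h1])
    have hdet := γ.det_coe
    rw [Matrix.det_fin_two] at hdet
    push_cast at hc hk
    have h4 : ∀ σ : UpperHalfPlane, (mul4 σ : ℂ) = 4 * σ := fun _ => rfl
    obtain ⟨hI, hJ⟩ := IJ_transform (γ 0 0) (4 * γ 0 1) c (γ 1 1) (4 * k)
      (by rw [hc] at hdet; linear_combination hdet) (by linear_combination hk)
      (mul4 τ) (mul4 (γ • τ))
      (by
        rw [h4, h4, sl_coe, hc, mul_div_assoc']; push_cast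
        congr 1 <;> ring)
    rw [hI, hJ]
    constructor
    · rw [Complex.exp_eq_one_iff.mpr, one_mul]
      exact ⟨-(3 * (γ 0 0 * γ 0 1)) + 6 * (k + γ 0 1), by push_cast; ring⟩
    · rw [Complex.exp_eq_one_iff.mpr, one_mul]
      exact ⟨-((γ 0 0 * γ 0 1)) + 2 * (k + γ 0 1), by push_cast; ring⟩
end

section
/- The functions g₁(τ)⁴ and g₂(τ)⁴ are invariant under Γ₁(10), i.e. g₁(γτ)⁴ = g₁(τ)⁴ and g₂(γτ)⁴ = g₂(τ)⁴ for all γ ∈ Γ₁(10) and τ ∈ ℍ; moreover T₁(τ) and T₂(τ) are invariant under Γ₁(40), i.e. T₁(γτ) = T₁(τ) and T₂(γτ) = T₂(τ) for all γ ∈ Γ₁(40) and τ ∈ ℍ. -/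
open Complex

/-- `g₁(τ) = (−q;q⁵)∞(−q⁴;q⁵)∞ / ((q;q⁵)∞(q⁴;q⁵)∞)` with `q = e^{2πiτ}`. -/
noncomputable def g1fun (τ : UpperHalfPlane) : ℂ :=
  qPoch (-Qc τ) (Qc τ ^ 5) * qPoch (-Qc τ ^ 4) (Qc τ ^ 5) /
    (qPoch (Qc τ) (Qc τ ^ 5) * qPoch (Qc τ ^ 4) (Qc τ ^ 5))

/-- `g₂(τ) = (−q²;q⁵)∞(−q³;q⁵)∞ / ((q²;q⁵)∞(q³;q⁵)∞)` with `q = e^{2πiτ}`. -/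
noncomputable def g2fun (τ : UpperHalfPlane) : ℂ :=
  qPoch (-Qc τ ^ 2) (Qc τ ^ 5) * qPoch (-Qc τ ^ 3) (Qc τ ^ 5) /
    (qPoch (Qc τ ^ 2) (Qc τ ^ 5) * qPoch (Qc τ ^ 3) (Qc τ ^ 5))

/-- `T₁(τ) = (g₁(τ) − 1)/(g₁(τ) + 1)`. -/
noncomputable def T1fun (τ : UpperHalfPlane) : ℂ := (g1fun τ - 1) / (g1fun τ + 1)

/-- `T₂(τ) = (g₂(τ) − 1)/(g₂(τ) + 1)`. -/
noncomputable def T2fun (τ : UpperHalfPlane) : ℂ := (g2fun τ - 1) / (g2fun τ + 1)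

section helper
open Filter Topology Finset

/-- The finite product `(q;q)_n`. -/
noncomputable def tpE (q : ℂ) (n : ℕ) : ℂ := ∏ k ∈ Finset.range n, (1 - q ^ (k + 1))

/-- `1/(q;q)_n`, extended by `0` to negative `n`. -/
noncomputable def tpR (q : ℂ) (n : ℤ) : ℂ := if n < 0 then 0 else (tpE q n.toNat)⁻¹

lemma tp_one_sub_ne {q : ℂ} (hq : ‖q‖ < 1) (n : ℕ) : 1 - q ^ (n + 1) ≠ 0 := by
  intro h
  have h1 : q ^ (n + 1) = 1 := (sub_eq_zero.mp h).symm
  have h2 : ‖q‖ ^ (n + 1) = 1 := by rw [← norm_pow, h1, norm_one]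
  have h3 : ‖q‖ ^ (n + 1) < 1 := pow_lt_one₀ (norm_nonneg _) hq (by omega)
  linarith

lemma tpE_ne {q : ℂ} (hq : ‖q‖ < 1) (n : ℕ) : tpE q n ≠ 0 :=
  Finset.prod_ne_zero_iff.mpr fun k _ => tp_one_sub_ne hq k

lemma tpR_rec {q : ℂ} (hq : ‖q‖ < 1) (n : ℤ) : tpR q (n - 1) = (1 - q ^ n) * tpR q n := by
  rcases lt_trichotomy n 0 with h | h | h
  · simp [tpR, h, show n - 1 < 0 by omega]
  · subst h; simp [tpR]
  · obtain ⟨m, rfl⟩ : ∃ m : ℕ, n = (m : ℤ) + 1 := ⟨(n - 1).toNat, by omega⟩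
    have h1 : ((m : ℤ) + 1).toNat = m + 1 := by omega
    have h2 : ¬ ((m : ℤ) + 1 < 0) := by omega
    have h3 : (q : ℂ) ^ ((m : ℤ) + 1) = q ^ (m + 1) := by exact_mod_cast zpow_natCast q (m + 1)
    have := tp_one_sub_ne hq m
    have h4 := tpE_ne hq m
    rw [tpR, tpR, if_neg h2, h1, h3]
    simp only [add_sub_cancel_right, Int.toNat_natCast]
    rw [if_neg (by omega), tpE, tpE, Finset.prod_range_succ]
    rw [tpE] at h4
    field_simp

lemma tpE_succ (q : ℂ) (n : ℕ) : tpE q (n + 1) = tpE q n * (1 - q ^ (n + 1)) := by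
  rw [tpE, Finset.prod_range_succ, ← tpE]

/-- coefficients with the exponential -/
noncomputable def tpS (z τ : ℂ) (j : ℤ) : ℂ := jacobiTheta₂_term j (z + 1 / 2 - τ / 2) τ

lemma tpS_succ (z τ : ℂ) (j : ℤ) : tpS z τ (j + 1) =
    - cexp (2 * Real.pi * I * z) * cexp (2 * Real.pi * I * τ) ^ j * tpS z τ j := by
  rw [tpS, tpS, jacobiTheta₂_term, jacobiTheta₂_term, ← Complex.exp_int_mul, ← neg_one_mul,
    ← Complex.exp_pi_mul_I, ← Complex.exp_add, ← Complex.exp_add, ← Complex.exp_add]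
  congr 1
  push_cast
  ring

lemma tpS_pred (z τ : ℂ) (j : ℤ) : tpS z τ (j - 1) =
    - (cexp (2 * Real.pi * I * z))⁻¹ * cexp (2 * Real.pi * I * τ) *
      (cexp (2 * Real.pi * I * τ) ^ j)⁻¹ * tpS z τ j := by
  have h := tpS_succ z τ (j - 1)
  rw [sub_add_cancel] at h
  rw [h, zpow_sub_one₀ (Complex.exp_ne_zero _)]
  have h1 := Complex.exp_ne_zero (2 * Real.pi * I * z)
  have h2 := Complex.exp_ne_zero (2 * Real.pi * I * τ)
  have h3 := zpow_ne_zero j h2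
  field_simp

lemma tp_q_norm {τ : ℂ} (hτ : 0 < τ.im) : ‖cexp (2 * Real.pi * I * τ)‖ < 1 := by
  rw [Complex.norm_exp, Real.exp_lt_one_iff]
  have : (2 * Real.pi * I * τ : ℂ).re = - (2 * Real.pi * τ.im) := by
    simp
  rw [this]
  have := Real.pi_pos
  have : 0 < 2 * Real.pi * τ.im := by positivity
  linarith

/-- Finite Jacobi triple product. -/
lemma tp_finite {τ : ℂ} (hτ : 0 < τ.im) (z : ℂ) (N : ℕ) :
    HasSum (fun j : ℤ => tpS z τ j * (tpE (cexp (2 * Real.pi * I * τ)) (2 * N) *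
        tpR (cexp (2 * Real.pi * I * τ)) (N + j) * tpR (cexp (2 * Real.pi * I * τ)) (N - j)))
      (∏ k ∈ Finset.range N, ((1 - cexp (2 * Real.pi * I * z) * cexp (2 * Real.pi * I * τ) ^ k) *
        (1 - (cexp (2 * Real.pi * I * τ) / cexp (2 * Real.pi * I * z)) *
          cexp (2 * Real.pi * I * τ) ^ k))) := by
  have hS := tpS_succ z τ
  have hP := tpS_pred z τ
  have hq := tp_q_norm hτ
  have hq0 := Complex.exp_ne_zero (2 * Real.pi * I * τ)
  have hx0 := Complex.exp_ne_zero (2 * Real.pi * I * z)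
  have hS0 : tpS z τ 0 = 1 := by simp [tpS, jacobiTheta₂_term]
  generalize cexp (2 * Real.pi * I * τ) = q at *
  generalize cexp (2 * Real.pi * I * z) = x at *
  induction N with
  | zero =>
    have : (fun j : ℤ => tpS z τ j * (tpE q (2 * 0) * tpR q ((0 : ℕ) + j) * tpR q ((0 : ℕ) - j)))
        = fun j : ℤ => if j = 0 then (1 : ℂ) else 0 := by
      funext j
      rcases lt_trichotomy j 0 with h | h | h
      · simp [tpR, h, h.ne]
      · subst h; simp [tpR, tpE, hS0]
      · simp [tpR, h, h.ne']
    rw [this]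
    simpa using hasSum_ite_eq (0 : ℤ) (1 : ℂ)
  | succ N ih =>
    have h1 := ih.mul_left (1 + q ^ (2 * N + 1))
    have h2 := ((Equiv.subRight (1 : ℤ)).hasSum_iff.mpr ih).mul_left (-(x * q ^ N))
    have h3 := ((Equiv.addRight (1 : ℤ)).hasSum_iff.mpr ih).mul_left (-(q ^ (N + 1) / x))
    have h4 := (h1.add h2).add h3
    rw [Finset.prod_range_succ]
    convert! h4 using 1
    · funext j
      simp only [Function.comp_apply, Equiv.subRight_apply, Equiv.coe_addRight]
      rw [hS, hP, show 2 * (N + 1) = 2 * N + 1 + 1 by ring, tpE_succ, tpE_succ]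
      have e1 : tpR q (N + j) = (1 - q ^ ((N : ℤ) + 1 + j)) * tpR q ((N : ℤ) + 1 + j) := by
        rw [← tpR_rec hq]; congr 1; ring
      have e2 : tpR q (N - j) = (1 - q ^ ((N : ℤ) + 1 - j)) * tpR q ((N : ℤ) + 1 - j) := by
        rw [← tpR_rec hq]; congr 1; ring
      have e3 : tpR q (N + (j - 1)) = (1 - q ^ ((N : ℤ) + j)) * tpR q (N + j) := by
        rw [← tpR_rec hq]; congr 1; ring
      have e4 : tpR q (N - (j + 1)) = (1 - q ^ ((N : ℤ) - j)) * tpR q (N - j) := by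
        rw [← tpR_rec hq]; congr 1; ring
      have e5 : tpR q (N + (j + 1)) = tpR q ((N : ℤ) + 1 + j) := by congr 1; ring
      have e6 : tpR q (N - (j - 1)) = tpR q ((N : ℤ) + 1 - j) := by congr 1; ring
      have e7 : ((N + 1 : ℕ) : ℤ) = (N : ℤ) + 1 := by push_cast; ring
      rw [e3, e4, e5, e6, e1, e2, e7]
      generalize tpR q ((N : ℤ) + 1 - j) = v
      generalize tpR q ((N : ℤ) + 1 + j) = u
      rw [zpow_add₀ hq0, zpow_sub₀ hq0, zpow_add₀ hq0, zpow_sub₀ hq0, zpow_add₀ hq0, zpow_natCast,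
        zpow_one]
      have hJ := zpow_ne_zero j hq0
      generalize q ^ j = J at *
      generalize tpS z τ j = s
      generalize tpE q (2 * N) = e
      have p1 : q ^ (2 * N + 1) = (q ^ N) ^ 2 * q := by ring
      have p2 : q ^ (2 * N + 1 + 1) = (q ^ N) ^ 2 * q ^ 2 := by ring
      have p3 : q ^ (N + 1) = q ^ N * q := by ring
      rw [p1, p2, p3]
      generalize q ^ N = Q
      field_simp
      ring
    · field_simp
      ring_nf

lemma tp_multipliable (a : ℂ) {q : ℂ} (hq : ‖q‖ < 1) :
    Multipliable fun n : ℕ ↦ 1 - a * q ^ n := by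
  have : Summable fun n : ℕ => ‖-(a * q ^ n)‖ := by
    simpa using (summable_geometric_of_lt_one (norm_nonneg _) hq).mul_left ‖a‖
  simpa [sub_eq_add_neg] using multipliable_one_add_of_summable this

lemma tpE_tendsto {q : ℂ} (hq : ‖q‖ < 1) :
    ∃ L : ℂ, L ≠ 0 ∧ Tendsto (tpE q) atTop (𝓝 L) := by
  refine ⟨∏' n : ℕ, (1 - q ^ (n + 1)), ?_, ?_⟩
  · have := tprod_one_add_ne_zero_of_summable (f := fun n : ℕ ↦ -q ^ (n + 1)) ?_ ?_
    · simpa [sub_eq_add_neg] using this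
    · intro i; simpa [sub_eq_add_neg] using tp_one_sub_ne hq i
    · simpa using (summable_nat_add_iff 1).mpr (summable_geometric_of_lt_one (norm_nonneg _) hq)
  · exact (ModularForm.multipliable_one_sub_pow hq).tendsto_prod_tprod_nat

/-- Jacobi triple product up to a constant. -/
lemma tp_main {τ : ℂ} (hτ : 0 < τ.im) : ∃ C : ℂ, C ≠ 0 ∧ ∀ z : ℂ,
    qPoch (cexp (2 * Real.pi * I * z)) (cexp (2 * Real.pi * I * τ)) *
    qPoch (cexp (2 * Real.pi * I * τ) / cexp (2 * Real.pi * I * z)) (cexp (2 * Real.pi * I * τ))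
    = C * jacobiTheta₂ (z + 1 / 2 - τ / 2) τ := by
  have hq := tp_q_norm hτ
  obtain ⟨L, hL, hE⟩ := tpE_tendsto hq
  refine ⟨L * L⁻¹ * L⁻¹, by positivity, fun z => ?_⟩
  have hfin := tp_finite hτ z
  set q := cexp (2 * Real.pi * I * τ) with hqdef
  set x := cexp (2 * Real.pi * I * z) with hxdef
  have hEinv : Tendsto (fun n => (tpE q n)⁻¹) atTop (𝓝 L⁻¹) := hE.inv₀ hL
  have hR : Tendsto (fun n : ℤ => tpR q n) atTop (𝓝 L⁻¹) := by
    have h1 : Tendsto (fun n : ℤ => (tpE q n.toNat)⁻¹) atTop (𝓝 L⁻¹) := by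
      refine hEinv.comp (tendsto_atTop_atTop.mpr fun b => ⟨b, fun a ha => by omega⟩)
    refine h1.congr' ?_
    filter_upwards [eventually_ge_atTop 0] with n hn
    simp [tpR, not_lt.mpr hn]
  obtain ⟨K1, hK1⟩ := (Metric.isBounded_range_of_tendsto _ hE).exists_norm_le
  obtain ⟨K2, hK2⟩ := (Metric.isBounded_range_of_tendsto _ hEinv).exists_norm_le
  have hK1' : ∀ n, ‖tpE q n‖ ≤ K1 := fun n => hK1 _ ⟨n, rfl⟩
  have hK10 : 0 ≤ K1 := (norm_nonneg _).trans (hK1' 0)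
  have hK20 : 0 ≤ K2 := (norm_nonneg _).trans (hK2 _ ⟨0, rfl⟩)
  have hK2' : ∀ n, ‖tpR q n‖ ≤ K2 := by
    intro n
    rw [tpR]
    split_ifs
    · simpa using hK20
    · exact hK2 _ ⟨n.toNat, rfl⟩
  have hlim1 : Tendsto (fun N : ℕ => ∑' j : ℤ, tpS z τ j * (tpE q (2 * N) *
        tpR q (N + j) * tpR q (N - j))) atTop (𝓝 (∑' j : ℤ, tpS z τ j * (L * L⁻¹ * L⁻¹))) := by
    refine tendsto_tsum_of_dominated_convergence (bound := fun j => ‖tpS z τ j‖ * (K1 * K2 * K2))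
      ?_ ?_ ?_
    · exact (((summable_jacobiTheta₂_term_iff _ _).mpr hτ).norm).mul_right _
    · intro j
      refine tendsto_const_nhds.mul ((Tendsto.mul ?_ ?_).mul ?_)
      · exact hE.comp (tendsto_atTop_atTop.mpr fun b => ⟨b, fun a ha => by omega⟩)
      · exact hR.comp (tendsto_atTop_atTop.mpr fun b => ⟨(b - j).toNat, fun a ha => by omega⟩)
      · exact hR.comp (tendsto_atTop_atTop.mpr fun b => ⟨(b + j).toNat, fun a ha => by omega⟩)
    · refine Eventually.of_forall fun N j => ?_
      rw [norm_mul, norm_mul, norm_mul]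
      gcongr
      · exact hK1' _
      · exact hK2' _
      · exact hK2' _
  have hlim2 : Tendsto (fun N : ℕ => ∑' j : ℤ, tpS z τ j * (tpE q (2 * N) *
        tpR q (N + j) * tpR q (N - j))) atTop (𝓝 (qPoch x q * qPoch (q / x) q)) := by
    simp_rw [fun N => (hfin N).tsum_eq, Finset.prod_mul_distrib]
    exact (tp_multipliable x hq).tendsto_prod_tprod_nat.mul
      (tp_multipliable (q / x) hq).tendsto_prod_tprod_nat
  rw [tendsto_nhds_unique hlim2 hlim1, tsum_mul_right, mul_comm]
  rfl

/-- Odd theta function (up to a factor depending on `τ` only). -/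
noncomputable def Th (z τ : ℂ) : ℂ :=
  cexp (-(Real.pi * I * z)) * jacobiTheta₂ (z + 1 / 2 - τ / 2) τ

lemma Th_add_one (z τ : ℂ) : Th (z + 1) τ = cexp (Real.pi * I) * Th z τ := by
  rw [Th, Th, show z + 1 + 1 / 2 - τ / 2 = (z + 1 / 2 - τ / 2) + 1 by ring, jacobiTheta₂_add_left,
    ← mul_assoc, ← Complex.exp_add]
  congr 1
  rw [Complex.exp_eq_exp_iff_exists_int]
  exact ⟨-1, by push_cast; ring⟩

lemma Th_add_tau (z τ : ℂ) :
    Th (z + τ) τ = cexp (Real.pi * I * (1 - τ - 2 * z)) * Th z τ := by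
  rw [Th, Th, show z + τ + 1 / 2 - τ / 2 = (z + 1 / 2 - τ / 2) + τ by ring, jacobiTheta₂_add_left',
    ← mul_assoc, ← mul_assoc, ← Complex.exp_add, ← Complex.exp_add]
  congr 1
  rw [Complex.exp_eq_exp_iff_exists_int]
  exact ⟨-1, by push_cast; ring⟩

lemma Th_add_int (z τ : ℂ) (n : ℤ) : Th (z + n) τ = cexp (Real.pi * I * n) * Th z τ := by
  induction n using Int.induction_on with
  | zero => simp
  | succ n ih =>
    have := Th_add_one (z + n) τ
    push_cast at ih ⊢
    rw [← add_assoc, this, ih, ← mul_assoc, ← Complex.exp_add]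
    congr 2; ring
  | pred n ih =>
    have := Th_add_one (z + (-n - 1)) τ
    push_cast at ih ⊢
    rw [show z + (-(n : ℂ) - 1) + 1 = z + -n by ring, ih] at this
    have h2 : Th (z + (-n - 1)) τ = cexp (-(Real.pi * I)) *
        (cexp (Real.pi * I) * Th (z + (-n - 1)) τ) := by
      rw [← mul_assoc, ← Complex.exp_add]; simp
    rw [h2, ← this, ← mul_assoc, ← Complex.exp_add]
    congr 2; ring

lemma Th_add_int_tau (z τ : ℂ) (m : ℤ) :
    Th (z + m * τ) τ = cexp (Real.pi * I * (m - m ^ 2 * τ - 2 * m * z)) * Th z τ := by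
  induction m using Int.induction_on with
  | zero => simp
  | succ n ih =>
    have := Th_add_tau (z + n * τ) τ
    push_cast at ih ⊢
    rw [show z + ((n : ℂ) + 1) * τ = z + n * τ + τ by ring, this, ih, ← mul_assoc,
      ← Complex.exp_add]
    congr 2; ring
  | pred n ih =>
    have := Th_add_tau (z + (-n - 1) * τ) τ
    push_cast at ih ⊢
    rw [show z + (-(n : ℂ) - 1) * τ + τ = z + -n * τ by ring, ih] at this
    have h2 : Th (z + (-n - 1) * τ) τ =
        cexp (-(Real.pi * I * (1 - τ - 2 * (z + (-n - 1) * τ)))) *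
        (cexp (Real.pi * I * (1 - τ - 2 * (z + (-n - 1) * τ))) * Th (z + (-n - 1) * τ) τ) := by
      rw [← mul_assoc, ← Complex.exp_add]; simp
    rw [h2, ← this, ← mul_assoc, ← Complex.exp_add]
    congr 2; ring

lemma Th_shift (z τ : ℂ) (m n : ℤ) : Th (z + m * τ + n) τ =
    cexp (Real.pi * I * (m + n - m ^ 2 * τ - 2 * m * z)) * Th z τ := by
  rw [Th_add_int, Th_add_int_tau, ← mul_assoc, ← Complex.exp_add]
  congr 2; ring

lemma Th_T (z τ : ℂ) : Th z (τ + 1) = Th z τ := by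
  rw [Th, Th]
  congr 1
  refine tsum_congr fun n => ?_
  rw [jacobiTheta₂_term, jacobiTheta₂_term, Complex.exp_eq_exp_iff_exists_int]
  obtain ⟨k, hk⟩ := Int.even_mul_succ_self (n - 1)
  refine ⟨k, ?_⟩
  have hk' : ((n : ℂ) - 1) * (n - 1 + 1) = k + k := by exact_mod_cast hk
  linear_combination (Real.pi * I) * hk'

lemma Th_S {τ : ℂ} (hτ : τ ≠ 0) : ∃ C : ℂ, C ≠ 0 ∧ ∀ z : ℂ,
    Th (z / τ) (-1 / τ) = C * cexp (Real.pi * I * z ^ 2 / τ) * Th z τ := by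
  have hs : (-I * τ) ^ (1 / 2 : ℂ) ≠ 0 := by
    rw [Complex.cpow_ne_zero_iff_of_exponent_ne_zero (by norm_num)]
    simp [hτ]
  refine ⟨(-I * τ) ^ (1 / 2 : ℂ) * cexp (Real.pi * I * (1 / (4 * τ) + τ / 4 - 1 / 2)),
    mul_ne_zero hs (Complex.exp_ne_zero _), fun z => ?_⟩
  have h1 := jacobiTheta₂_functional_equation (z + 1 / 2 - τ / 2 + τ) τ
  rw [jacobiTheta₂_add_left'] at h1
  have h2 : jacobiTheta₂ ((z + 1 / 2 - τ / 2 + τ) / τ) (-1 / τ) = (-I * τ) ^ (1 / 2 : ℂ) *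
      cexp (Real.pi * I * (z + 1 / 2 - τ / 2 + τ) ^ 2 / τ) *
      (cexp (-Real.pi * I * (τ + 2 * (z + 1 / 2 - τ / 2))) *
        jacobiTheta₂ (z + 1 / 2 - τ / 2) τ) := by
    rw [h1, show -(Real.pi : ℂ) * I * (z + 1 / 2 - τ / 2 + τ) ^ 2 / τ =
      -(Real.pi * I * (z + 1 / 2 - τ / 2 + τ) ^ 2 / τ) by ring, Complex.exp_neg]
    have := Complex.exp_ne_zero (Real.pi * I * (z + 1 / 2 - τ / 2 + τ) ^ 2 / τ)
    field_simp
  rw [Th, Th, show z / τ + 1 / 2 - -1 / τ / 2 = (z + 1 / 2 - τ / 2 + τ) / τ by field_simp; ring,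
    h2]
  have h3 : cexp (-(Real.pi * I * (z / τ))) *
      (cexp (Real.pi * I * (z + 1 / 2 - τ / 2 + τ) ^ 2 / τ) *
      cexp (-Real.pi * I * (τ + 2 * (z + 1 / 2 - τ / 2)))) =
      cexp (Real.pi * I * (1 / (4 * τ) + τ / 4 - 1 / 2)) * (cexp (Real.pi * I * z ^ 2 / τ) *
        cexp (-(Real.pi * I * z))) := by
    simp only [← Complex.exp_add]
    congr 1
    field_simp
    ring
  linear_combination ((-I * τ) ^ (1 / 2 : ℂ) * jacobiTheta₂ (z + 1 / 2 - τ / 2) τ) * h3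

/-- Modular transformation property of `Th`. -/
def ThMod (g : Matrix.SpecialLinearGroup (Fin 2) ℤ) : Prop :=
  ∀ τ : UpperHalfPlane, ∃ C : ℂ, C ≠ 0 ∧ ∀ z : ℂ,
    Th (z / ((g 1 0 : ℂ) * τ + (g 1 1 : ℂ))) ((g • τ : UpperHalfPlane) : ℂ) =
      C * cexp (Real.pi * I * ((g 1 0 : ℂ) * z ^ 2 / ((g 1 0 : ℂ) * τ + (g 1 1 : ℂ)))) * Th z τ

lemma den_ne (g : Matrix.SpecialLinearGroup (Fin 2) ℤ) (τ : UpperHalfPlane) :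
    (g 1 0 : ℂ) * τ + (g 1 1 : ℂ) ≠ 0 := by
  have := UpperHalfPlane.denom_ne_zero (g : GL (Fin 2) ℝ) τ
  simpa [UpperHalfPlane.denom] using this

lemma coe_act (g : Matrix.SpecialLinearGroup (Fin 2) ℤ) (τ : UpperHalfPlane) :
    ((g • τ : UpperHalfPlane) : ℂ) =
      ((g 0 0 : ℂ) * τ + (g 0 1 : ℂ)) / ((g 1 0 : ℂ) * τ + (g 1 1 : ℂ)) := by
  simpa using UpperHalfPlane.coe_specialLinearGroup_apply g τ

lemma det_eq (g : Matrix.SpecialLinearGroup (Fin 2) ℤ) :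
    (g 0 0 : ℂ) * g 1 1 - (g 0 1 : ℂ) * g 1 0 = 1 := by
  have := g.det_coe
  rw [Matrix.det_fin_two] at this
  exact_mod_cast this

lemma cocycle (g h : Matrix.SpecialLinearGroup (Fin 2) ℤ) (τ : UpperHalfPlane) :
    ((g * h) 1 0 : ℂ) * τ + ((g * h) 1 1 : ℂ) =
      ((g 1 0 : ℂ) * ((h • τ : UpperHalfPlane) : ℂ) + (g 1 1 : ℂ)) *
      ((h 1 0 : ℂ) * τ + (h 1 1 : ℂ)) := by
  have := den_ne h τ
  rw [coe_act]
  simp only [Matrix.SpecialLinearGroup.coe_mul, Matrix.mul_apply, Fin.sum_univ_two]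
  push_cast
  field_simp
  ring

lemma ThMod_mul {g h : Matrix.SpecialLinearGroup (Fin 2) ℤ} (hg : ThMod g) (hh : ThMod h) :
    ThMod (g * h) := by
  intro τ
  obtain ⟨C, hC, h1⟩ := hg (h • τ)
  obtain ⟨D, hD, h2⟩ := hh τ
  refine ⟨C * D, mul_ne_zero hC hD, fun z => ?_⟩
  have hco := cocycle g h τ
  have hn1 := den_ne h τ
  have hn2 := den_ne g (h • τ)
  have hn3 := den_ne (g * h) τ
  have hdet := det_eq h
  have hc : ((g * h) 1 0 : ℂ) = g 1 0 * h 0 0 + g 1 1 * h 1 0 := by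
    simp [Matrix.mul_apply, Fin.sum_univ_two]
  have hd : ((g * h) 1 1 : ℂ) = g 1 0 * h 0 1 + g 1 1 * h 1 1 := by
    simp [Matrix.mul_apply, Fin.sum_univ_two]
  have key : (g 1 0 : ℂ) + h 1 0 * (((g * h) 1 0 : ℂ) * τ + ((g * h) 1 1 : ℂ)) =
      ((g * h) 1 0 : ℂ) * ((h 1 0 : ℂ) * τ + (h 1 1 : ℂ)) := by
    rw [hc, hd]
    linear_combination (-(g 1 0 : ℂ)) * hdet
  have e1 : z / (((g * h) 1 0 : ℂ) * τ + ((g * h) 1 1 : ℂ)) =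
      z / ((h 1 0 : ℂ) * τ + (h 1 1 : ℂ)) /
        ((g 1 0 : ℂ) * ((h • τ : UpperHalfPlane) : ℂ) + (g 1 1 : ℂ)) := by
    rw [hco, div_div, mul_comm]
  rw [mul_smul, e1, h1, h2]
  have e2 : cexp (Real.pi * I * (((g * h) 1 0 : ℂ) * z ^ 2 /
      (((g * h) 1 0 : ℂ) * τ + ((g * h) 1 1 : ℂ)))) =
      cexp (Real.pi * I * ((g 1 0 : ℂ) * (z / ((h 1 0 : ℂ) * τ + (h 1 1 : ℂ))) ^ 2 /
        ((g 1 0 : ℂ) * ((h • τ : UpperHalfPlane) : ℂ) + (g 1 1 : ℂ)))) *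
      cexp (Real.pi * I * ((h 1 0 : ℂ) * z ^ 2 / ((h 1 0 : ℂ) * τ + (h 1 1 : ℂ)))) := by
    rw [← Complex.exp_add, ← mul_add]
    congr 2
    have : ((g * h) 1 0 : ℂ) * z ^ 2 / (((g * h) 1 0 : ℂ) * τ + ((g * h) 1 1 : ℂ)) =
      z ^ 2 * ((g 1 0 : ℂ) + h 1 0 * (((g * h) 1 0 : ℂ) * τ + ((g * h) 1 1 : ℂ))) /
       ((((g * h) 1 0 : ℂ) * τ + ((g * h) 1 1 : ℂ)) * ((h 1 0 : ℂ) * τ + (h 1 1 : ℂ))) := by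
      rw [key, ← mul_div_mul_right _ _ hn1]
      congr 1; ring
    rw [this, hco]
    field_simp
  rw [e2]
  ring

lemma ThMod_one : ThMod 1 := by
  intro τ
  exact ⟨1, one_ne_zero, fun z => by simp⟩

lemma ThMod_inv {g : Matrix.SpecialLinearGroup (Fin 2) ℤ} (hg : ThMod g) : ThMod g⁻¹ := by
  intro τ
  obtain ⟨C, hC, h1⟩ := hg (g⁻¹ • τ)
  refine ⟨C⁻¹, inv_ne_zero hC, fun z => ?_⟩
  have hco := cocycle g g⁻¹ τ
  have hn1 := den_ne g⁻¹ τ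
  have hn2 := den_ne g (g⁻¹ • τ)
  have h2 := h1 (z / ((g⁻¹ 1 0 : ℂ) * τ + (g⁻¹ 1 1 : ℂ)))
  rw [smul_inv_smul, div_div, mul_comm ((g⁻¹ 1 0 : ℂ) * τ + (g⁻¹ 1 1 : ℂ)), ← hco,
    mul_inv_cancel] at h2
  rw [mul_inv_cancel] at hco
  have hc : (g⁻¹ 1 0 : ℂ) = -(g 1 0 : ℂ) := by
    simp [Matrix.SpecialLinearGroup.coe_inv, Matrix.adjugate_fin_two]
  simp only [Matrix.SpecialLinearGroup.coe_one, Matrix.one_apply_eq, Int.cast_one,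
    ne_eq, one_ne_zero, not_false_eq_true, Matrix.one_apply_ne, Int.cast_zero, zero_mul,
    zero_add, div_one] at h2 hco
  rw [h2]
  have e : cexp (Real.pi * I * ((g⁻¹ 1 0 : ℂ) * z ^ 2 / ((g⁻¹ 1 0 : ℂ) * τ + (g⁻¹ 1 1 : ℂ)))) *
      cexp (Real.pi * I * ((g 1 0 : ℂ) * (z / ((g⁻¹ 1 0 : ℂ) * τ + (g⁻¹ 1 1 : ℂ))) ^ 2 /
        ((g 1 0 : ℂ) * ((g⁻¹ • τ : UpperHalfPlane) : ℂ) + (g 1 1 : ℂ)))) = 1 := by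
    rw [← Complex.exp_add, ← mul_add]
    have h3 : (g 1 0 : ℂ) * ((g⁻¹ • τ : UpperHalfPlane) : ℂ) + (g 1 1 : ℂ) =
      ((g⁻¹ 1 0 : ℂ) * τ + (g⁻¹ 1 1 : ℂ))⁻¹ := eq_inv_of_mul_eq_one_left hco.symm
    rw [h3]
    generalize (g⁻¹ 1 0 : ℂ) * τ + (g⁻¹ 1 1 : ℂ) = j at *
    rw [hc]
    have : -(g 1 0 : ℂ) * z ^ 2 / j + (g 1 0 : ℂ) * (z / j) ^ 2 / j⁻¹ = 0 := by
      field_simp; ring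
    rw [this]; simp
  linear_combination (-(Th (z / ((g⁻¹ 1 0 : ℂ) * τ + (g⁻¹ 1 1 : ℂ)))
    ((g⁻¹ • τ : UpperHalfPlane) : ℂ))) * e + (-(cexp (Real.pi * I * ((g⁻¹ 1 0 : ℂ) * z ^ 2 / ((g⁻¹ 1 0 : ℂ) * τ + (g⁻¹ 1 1 : ℂ)))) *
      cexp (Real.pi * I * ((g 1 0 : ℂ) * (z / ((g⁻¹ 1 0 : ℂ) * τ + (g⁻¹ 1 1 : ℂ))) ^ 2 /
        ((g 1 0 : ℂ) * ((g⁻¹ • τ : UpperHalfPlane) : ℂ) + (g 1 1 : ℂ))))) * Th (z / ((g⁻¹ 1 0 : ℂ) * τ + (g⁻¹ 1 1 : ℂ)))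
    ((g⁻¹ • τ : UpperHalfPlane) : ℂ)) * (inv_mul_cancel₀ hC)

lemma ThMod_all (g : Matrix.SpecialLinearGroup (Fin 2) ℤ) : ThMod g := by
  have : g ∈ Subgroup.closure {ModularGroup.S, ModularGroup.T} := by
    simp [SpecialLinearGroup.SL2Z_generators]
  induction this using Subgroup.closure_induction with
  | one => exact ThMod_one
  | mem g hg =>
    simp only [Set.mem_insert_iff, Set.mem_singleton_iff] at hg
    rcases hg with rfl | rfl
    · intro τ
      obtain ⟨C, hC, h⟩ := Th_S (τ := (τ : ℂ)) τ.ne_zero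
      refine ⟨C, hC, fun z => ?_⟩
      have h1 := h z
      rw [coe_act]
      simp only [ModularGroup.S, Matrix.SpecialLinearGroup.coe_mk]
      simp
      rw [h1]
      congr 3; ring
    · intro τ
      refine ⟨1, one_ne_zero, fun z => ?_⟩
      have h1 := Th_T z τ
      rw [coe_act]
      simp [ModularGroup.T, h1]
  | mul g h _ _ ig ih => exact ThMod_mul ig ih
  | inv g _ ig => exact ThMod_inv ig

/-- Transformation of the ratio. -/
lemma ratio_transform (k a1 b c1 d1 : ℤ)
    (hdet : (1 + 10 * a1) * (1 + 10 * d1) - b * (10 * c1) = 1) (τ τ' : ℂ) (hτ : 0 < τ.im)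
    (hτ' : τ' = ((1 + 10 * a1) * τ + b) / (10 * c1 * τ + (1 + 10 * d1))) :
    Th (k * τ' + 1 / 2) (5 * τ') / Th (k * τ') (5 * τ') =
    cexp (Real.pi * I * (2 * c1 * k * b + c1 / 2 + 5 * c1 * d1 + 5 * d1 - 2 * k * a1)) *
      (Th (k * τ + 1 / 2) (5 * τ) / Th (k * τ) (5 * τ)) := by
  let g : Matrix.SpecialLinearGroup (Fin 2) ℤ :=
    ⟨!![1 + 10 * a1, 5 * b; 2 * c1, 1 + 10 * d1], by
      rw [Matrix.det_fin_two_of]; linarith⟩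
  let σ : UpperHalfPlane := ⟨5 * τ, by simpa using hτ⟩
  have hσ : (σ : ℂ) = 5 * τ := rfl
  have g00 : (g 0 0 : ℂ) = 1 + 10 * a1 := by simp [g]
  have g01 : (g 0 1 : ℂ) = 5 * b := by simp [g]
  have g10 : (g 1 0 : ℂ) = 2 * c1 := by simp [g]
  have g11 : (g 1 1 : ℂ) = 1 + 10 * d1 := by simp [g]
  have hn := den_ne g σ
  have hact := coe_act g σ
  obtain ⟨C, hC, h⟩ := ThMod_all g σ
  rw [g10, g11, hσ] at h hn
  rw [g00, g01, g10, g11, hσ] at hact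
  rw [show 2 * (c1 : ℂ) * (5 * τ) = 10 * c1 * τ by ring] at h hn hact
  have hj : 10 * (c1 : ℂ) * τ + (1 + 10 * d1) ≠ 0 := hn
  have hact' : ((g • σ : UpperHalfPlane) : ℂ) = 5 * τ' := by
    rw [hact, hτ']; field_simp
  rw [hact'] at h
  have half : ∀ X j : ℂ, j ≠ 0 → (k * X + j / 2) / j = k * (X / j) + 1 / 2 := by
    intro X j hj; field_simp
  have A1 := h (k * ((1 + 10 * a1) * τ + b))
  have A2 := h (k * ((1 + 10 * a1) * τ + b) + (10 * c1 * τ + (1 + 10 * d1)) / 2)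
  rw [show k * ((1 + 10 * a1) * τ + b) / (10 * c1 * τ + (1 + 10 * d1)) = k * τ' by
    rw [hτ']; ring] at A1
  rw [show (k * ((1 + 10 * a1) * τ + b) + (10 * c1 * τ + (1 + 10 * d1)) / 2) /
    (10 * c1 * τ + (1 + 10 * d1)) = k * τ' + 1 / 2 by
    rw [hτ']; exact half _ _ hj] at A2
  have B1 := Th_shift (k * τ) (5 * τ) (2 * k * a1) (k * b)
  have B2 := Th_shift (k * τ + 1 / 2) (5 * τ) (2 * k * a1 + c1) (k * b + 5 * d1)
  push_cast at B1 B2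
  rw [show (k : ℂ) * τ + 2 * k * a1 * (5 * τ) + k * b = k * ((1 + 10 * a1) * τ + b) by ring] at B1
  rw [show (k : ℂ) * τ + 1 / 2 + (2 * k * a1 + c1) * (5 * τ) + (k * b + 5 * d1) =
    k * ((1 + 10 * a1) * τ + b) + (10 * c1 * τ + (1 + 10 * d1)) / 2 by ring] at B2
  rw [A1, A2, B1, B2]
  generalize hj' : 10 * (c1 : ℂ) * τ + (1 + 10 * d1) = j at *
  have E : cexp (Real.pi * I * (2 * c1 * (k * ((1 + 10 * a1) * τ + b) + j / 2) ^ 2 / j)) *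
      cexp (Real.pi * I * (2 * k * a1 + c1 + (k * b + 5 * d1) -
        (2 * k * a1 + c1) ^ 2 * (5 * τ) - 2 * (2 * k * a1 + c1) * (k * τ + 1 / 2))) =
      cexp (Real.pi * I * (2 * c1 * k * b + c1 / 2 + 5 * c1 * d1 + 5 * d1 - 2 * k * a1)) *
      (cexp (Real.pi * I * (2 * c1 * (k * ((1 + 10 * a1) * τ + b)) ^ 2 / j)) *
      cexp (Real.pi * I * (2 * k * a1 + k * b - (2 * k * a1) ^ 2 * (5 * τ) -
        2 * (2 * k * a1) * (k * τ)))) := by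
    simp only [← Complex.exp_add, ← mul_add]
    congr 2
    have : 2 * (c1 : ℂ) * (k * ((1 + 10 * a1) * τ + b) + j / 2) ^ 2 / j =
      2 * c1 * (k * ((1 + 10 * a1) * τ + b)) ^ 2 / j +
      2 * c1 * (k * ((1 + 10 * a1) * τ + b) + j / 4) := by
      field_simp; ring
    rw [this, ← hj']
    ring
  have n1 := Complex.exp_ne_zero (Real.pi * I * (2 * c1 * (k * ((1 + 10 * a1) * τ + b)) ^ 2 / j))
  have n2 := Complex.exp_ne_zero (Real.pi * I * (2 * k * a1 + k * b -
    (2 * k * a1) ^ 2 * (5 * τ) - 2 * (2 * k * a1) * (k * τ)))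
  rw [← mul_assoc, mul_assoc C, E]
  generalize cexp (Real.pi * I * (2 * c1 * (k * ((1 + 10 * a1) * τ + b)) ^ 2 / j)) = u at *
  generalize cexp (Real.pi * I * (2 * k * a1 + k * b -
    (2 * k * a1) ^ 2 * (5 * τ) - 2 * (2 * k * a1) * (k * τ))) = v at *
  generalize Th (k * τ + 1 / 2) (5 * τ) = X
  generalize Th (k * τ) (5 * τ) = Y
  rw [show C * u * (v * Y) = (C * u * v) * Y by ring]
  rw [show ∀ w : ℂ, C * (w * (u * v)) * X = (C * u * v) * (w * X) by intro w; ring]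
  rw [mul_div_mul_left _ _ (by simp [hC, n1, n2]), mul_div_assoc]

lemma poch_ratio (z : ℂ) {σ : ℂ} (hσ : 0 < σ.im) :
    qPoch (-cexp (2 * Real.pi * I * z)) (cexp (2 * Real.pi * I * σ)) *
    qPoch (-(cexp (2 * Real.pi * I * σ) / cexp (2 * Real.pi * I * z)))
      (cexp (2 * Real.pi * I * σ)) /
    (qPoch (cexp (2 * Real.pi * I * z)) (cexp (2 * Real.pi * I * σ)) *
    qPoch (cexp (2 * Real.pi * I * σ) / cexp (2 * Real.pi * I * z))
      (cexp (2 * Real.pi * I * σ))) = I * (Th (z + 1 / 2) σ / Th z σ) := by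
  obtain ⟨C, hC, h⟩ := tp_main hσ
  have e : cexp (2 * Real.pi * I * (z + 1 / 2)) = -cexp (2 * Real.pi * I * z) := by
    rw [mul_add, Complex.exp_add, show 2 * Real.pi * I * (1 / 2) = Real.pi * I by ring,
      Complex.exp_pi_mul_I]; ring
  have h1 := h (z + 1 / 2)
  rw [e, div_neg] at h1
  rw [h1, h z, mul_div_mul_left _ _ hC, Th, Th,
    show -(Real.pi * I * (z + 1 / 2)) = -(Real.pi * I * z) + -(Real.pi / 2 * I) by ring,
    Complex.exp_add, Complex.exp_neg (Real.pi / 2 * I), Complex.exp_pi_div_two_mul_I, mul_assoc,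
    mul_div_mul_left _ _ (Complex.exp_ne_zero _), mul_div_assoc, ← mul_assoc]
  simp

lemma g1_eq (τ : UpperHalfPlane) :
    g1fun τ = I * (Th ((1 : ℤ) * τ + 1 / 2) (5 * τ) / Th ((1 : ℤ) * τ) (5 * τ)) := by
  have h5 : cexp (2 * Real.pi * I * (5 * τ)) = Qc τ ^ 5 := by
    rw [Qc, ← Complex.exp_nat_mul]; congr 1; push_cast; ring
  have hz : cexp (2 * Real.pi * I * ((1 : ℤ) * τ)) = Qc τ := by
    rw [Qc]; congr 1; push_cast; ring
  have h0 : Qc τ ≠ 0 := Complex.exp_ne_zero _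
  rw [← poch_ratio _ (by simpa using τ.im_pos), h5, hz, show Qc τ ^ 5 / Qc τ = Qc τ ^ 4 by
    field_simp]
  rfl

lemma g2_eq (τ : UpperHalfPlane) :
    g2fun τ = I * (Th ((2 : ℤ) * τ + 1 / 2) (5 * τ) / Th ((2 : ℤ) * τ) (5 * τ)) := by
  have h5 : cexp (2 * Real.pi * I * (5 * τ)) = Qc τ ^ 5 := by
    rw [Qc, ← Complex.exp_nat_mul]; congr 1; push_cast; ring
  have hz : cexp (2 * Real.pi * I * ((2 : ℤ) * τ)) = Qc τ ^ 2 := by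
    rw [Qc, ← Complex.exp_nat_mul]; congr 1; push_cast; ring
  have h0 : Qc τ ≠ 0 := Complex.exp_ne_zero _
  rw [← poch_ratio _ (by simpa using τ.im_pos), h5, hz, show Qc τ ^ 5 / Qc τ ^ 2 = Qc τ ^ 3 by
    field_simp]
  rfl

lemma gamma_form {M : ℕ} {g : Matrix.SpecialLinearGroup (Fin 2) ℤ}
    (hg : g ∈ CongruenceSubgroup.Gamma1 M) :
    ∃ a b c d : ℤ, g 0 0 = 1 + M * a ∧ g 0 1 = b ∧ g 1 0 = M * c ∧ g 1 1 = 1 + M * d := by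
  rw [CongruenceSubgroup.Gamma1_mem] at hg
  obtain ⟨h1, h2, h3⟩ := hg
  have k1 : ((g 0 0 - 1 : ℤ) : ZMod M) = 0 := by push_cast; rw [h1]; simp
  have k2 : ((g 1 1 - 1 : ℤ) : ZMod M) = 0 := by push_cast; rw [h2]; simp
  rw [ZMod.intCast_zmod_eq_zero_iff_dvd] at k1 k2
  have k3 := (ZMod.intCast_zmod_eq_zero_iff_dvd _ _).mp h3
  obtain ⟨a, ha⟩ := k1
  obtain ⟨d, hd⟩ := k2
  obtain ⟨c, hc⟩ := k3
  exact ⟨a, _, c, d, by linarith, rfl, hc, by linarith⟩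

lemma ratio_gamma (g : Matrix.SpecialLinearGroup (Fin 2) ℤ) (k a1 b c1 d1 : ℤ)
    (h00 : g 0 0 = 1 + 10 * a1) (h01 : g 0 1 = b) (h10 : g 1 0 = 10 * c1)
    (h11 : g 1 1 = 1 + 10 * d1) (τ : UpperHalfPlane) :
    Th (k * ((g • τ : UpperHalfPlane) : ℂ) + 1 / 2) (5 * ((g • τ : UpperHalfPlane) : ℂ)) /
      Th (k * ((g • τ : UpperHalfPlane) : ℂ)) (5 * ((g • τ : UpperHalfPlane) : ℂ)) =
    cexp (Real.pi * I * (2 * c1 * k * b + c1 / 2 + 5 * c1 * d1 + 5 * d1 - 2 * k * a1)) *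
      (Th (k * τ + 1 / 2) (5 * τ) / Th (k * τ) (5 * τ)) := by
  refine ratio_transform k a1 b c1 d1 ?_ τ _ τ.im_pos ?_
  · have := g.det_coe
    rw [Matrix.det_fin_two, h00, h01, h10, h11] at this
    linarith
  · rw [coe_act, h00, h01, h10, h11]
    push_cast
    rfl

lemma ratio_pow (g : Matrix.SpecialLinearGroup (Fin 2) ℤ)
    (hg : g ∈ CongruenceSubgroup.Gamma1 10) (k : ℤ) (τ : UpperHalfPlane) :
    (I * (Th (k * ((g • τ : UpperHalfPlane) : ℂ) + 1 / 2) (5 * ((g • τ : UpperHalfPlane) : ℂ)) /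
      Th (k * ((g • τ : UpperHalfPlane) : ℂ)) (5 * ((g • τ : UpperHalfPlane) : ℂ)))) ^ 4 =
    (I * (Th (k * τ + 1 / 2) (5 * τ) / Th (k * τ) (5 * τ))) ^ 4 := by
  obtain ⟨a, b, c, d, h1, h2, h3, h4⟩ := gamma_form hg
  rw [ratio_gamma g k a b c d (by exact_mod_cast h1) h2 (by exact_mod_cast h3)
    (by exact_mod_cast h4) τ, mul_left_comm, mul_pow, ← Complex.exp_nat_mul]
  have : cexp ((4 : ℕ) * (Real.pi * I * (2 * c * k * b + c / 2 + 5 * c * d + 5 * d - 2 * k * a)))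
      = 1 := by
    rw [Complex.exp_eq_one_iff]
    exact ⟨4 * c * k * b + c + 10 * c * d + 10 * d - 4 * k * a, by push_cast; ring⟩
  rw [this, one_mul]

lemma ratio_inv (g : Matrix.SpecialLinearGroup (Fin 2) ℤ)
    (hg : g ∈ CongruenceSubgroup.Gamma1 40) (k : ℤ) (τ : UpperHalfPlane) :
    I * (Th (k * ((g • τ : UpperHalfPlane) : ℂ) + 1 / 2) (5 * ((g • τ : UpperHalfPlane) : ℂ)) /
      Th (k * ((g • τ : UpperHalfPlane) : ℂ)) (5 * ((g • τ : UpperHalfPlane) : ℂ))) =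
    I * (Th (k * τ + 1 / 2) (5 * τ) / Th (k * τ) (5 * τ)) := by
  obtain ⟨a, b, c, d, h1, h2, h3, h4⟩ := gamma_form hg
  push_cast at h1 h3 h4
  rw [ratio_gamma g k (4 * a) b (4 * c) (4 * d) (by linarith) h2 (by linarith)
    (by linarith) τ]
  have : cexp (Real.pi * I * (2 * (4 * c : ℤ) * k * b + (4 * c : ℤ) / 2 +
      5 * (4 * c : ℤ) * (4 * d : ℤ) + 5 * (4 * d : ℤ) - 2 * k * (4 * a : ℤ))) = 1 := by
    rw [Complex.exp_eq_one_iff]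
    exact ⟨4 * c * k * b + c + 40 * c * d + 10 * d - 4 * k * a, by push_cast; ring⟩
  rw [this, one_mul]

end helper

/-- `g₁(τ)⁴` and `g₂(τ)⁴` are invariant under `Γ₁(10)`, and `T₁(τ)`, `T₂(τ)` are invariant
under `Γ₁(40)`. -/
theorem statement5 :
    (∀ γ : CongruenceSubgroup.Gamma1 10, ∀ τ : UpperHalfPlane,
        g1fun ((γ : Matrix.SpecialLinearGroup (Fin 2) ℤ) • τ) ^ 4 = g1fun τ ^ 4 ∧
        g2fun ((γ : Matrix.SpecialLinearGroup (Fin 2) ℤ) • τ) ^ 4 = g2fun τ ^ 4) ∧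
    (∀ γ : CongruenceSubgroup.Gamma1 40, ∀ τ : UpperHalfPlane,
        T1fun ((γ : Matrix.SpecialLinearGroup (Fin 2) ℤ) • τ) = T1fun τ ∧
        T2fun ((γ : Matrix.SpecialLinearGroup (Fin 2) ℤ) • τ) = T2fun τ) := by
  refine ⟨fun γ τ => ⟨?_, ?_⟩, fun γ τ => ⟨?_, ?_⟩⟩
  · rw [g1_eq, g1_eq]; exact ratio_pow _ γ.2 1 τ
  · rw [g2_eq, g2_eq]; exact ratio_pow _ γ.2 2 τ
  · rw [T1fun, T1fun, g1_eq, g1_eq, ratio_inv _ γ.2 1 τ]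
  · rw [T2fun, T2fun, g2_eq, g2_eq, ratio_inv _ γ.2 2 τ]
end

section
/- The function τ ↦ U(2τ) is modular on Γ₀(20) with character (5/·): for every γ = [a b; c d] ∈ SL₂(ℤ) with 20 ∣ c and every τ ∈ ℍ, one has U(2·γτ) = (5/d)·U(2τ), where (5/d) is the Jacobi (Legendre) symbol. -/
open Complex

/-- `U(τ) = q^{1/2}·(q;q)∞(q¹⁰;q¹⁰)∞² / ((q²;q²)∞²(q⁵;q⁵)∞)` with `q^{1/2} = e^{πiτ}`;
this is the η-quotient `η(τ)η(10τ)²/(η(2τ)²η(5τ))`. -/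
noncomputable def Ufun (τ : UpperHalfPlane) : ℂ :=
  Complex.exp (Real.pi * Complex.I * τ) *
    (qPoch (Qc τ) (Qc τ) * qPoch (Qc τ ^ 10) (Qc τ ^ 10) ^ 2) /
    (qPoch (Qc τ ^ 2) (Qc τ ^ 2) ^ 2 * qPoch (Qc τ ^ 5) (Qc τ ^ 5))


/-- The point `2τ` of the upper half-plane. -/
noncomputable def dbl (τ : UpperHalfPlane) : UpperHalfPlane := ⟨2 * (τ : ℂ), by simpa using τ.2⟩


namespace UEta

open ModularForm

/-- multiplicativity of the principal square root under a sign condition -/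
lemma sqrt_mul_of_re {a b : ℂ} (ha : a ≠ 0) (hb : b ≠ 0) (h1 : 0 ≤ a.re)
    (h2 : 0 ≤ b.re ∧ 0 < a.re ∨ 0 < (a * b).re) :
    Complex.sqrt (a * b) = Complex.sqrt a * Complex.sqrt b := by
  have hA := Complex.abs_arg_le_pi_div_two_iff.2 h1
  rw [abs_le] at hA
  have hB1 := Complex.neg_pi_lt_arg b
  have hB2 := Complex.arg_le_pi b
  have key : Complex.arg a + Complex.arg b ∈ Set.Ioc (-Real.pi) Real.pi := by
    rcases h2 with ⟨h2, h3⟩ | h2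
    · have hB := Complex.abs_arg_le_pi_div_two_iff.2 h2
      rw [abs_le] at hB
      have hA' := Complex.abs_arg_lt_pi_div_two_iff.2 (Or.inl h3)
      rw [abs_lt] at hA'
      constructor <;> linarith
    · have hre : (a * b).re = ‖a‖ * ‖b‖ * Real.cos (Complex.arg a + Complex.arg b) := by
        rw [Real.cos_add, Complex.mul_re]
        have e1 := Complex.norm_mul_cos_arg a
        have e2 := Complex.norm_mul_sin_arg a
        have e3 := Complex.norm_mul_cos_arg b
        have e4 := Complex.norm_mul_sin_arg b
        rw [← e1, ← e2, ← e3, ← e4]; ring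
      have hcos : 0 < Real.cos (Complex.arg a + Complex.arg b) := by
        by_contra hc
        push Not at hc
        have : ‖a‖ * ‖b‖ * Real.cos (Complex.arg a + Complex.arg b) ≤ 0 :=
          mul_nonpos_of_nonneg_of_nonpos (by positivity) hc
        linarith
      constructor
      · by_contra hc
        push Not at hc
        have := Real.cos_nonpos_of_pi_div_two_le_of_le
          (x := -(Complex.arg a + Complex.arg b)) (by linarith [Real.pi_pos]) (by linarith)
        rw [Real.cos_neg] at this
        linarith
      · by_contra hc
        push Not at hc
        have := Real.cos_nonpos_of_pi_div_two_le_of_le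
          (x := (Complex.arg a + Complex.arg b)) (by linarith [Real.pi_pos]) (by linarith)
        linarith
  rw [sqrt_eq_exp ha, sqrt_eq_exp hb, sqrt_eq_exp (mul_ne_zero ha hb),
    ← Complex.exp_add, (Complex.log_mul_eq_add_log_iff ha hb).2 key]
  congr 1; ring

/-- the automorphy square root `√(-iz)` -/
noncomputable def s (z : ℂ) : ℂ := Complex.sqrt (-I * z)

lemma s_sq (z : ℂ) (hz : z ≠ 0) : s z ^ 2 = -I * z := by
  have h : -I * z ≠ 0 := mul_ne_zero (neg_ne_zero.2 I_ne_zero) hz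
  rw [s, sqrt_eq_exp h, ← Complex.exp_nat_mul]
  convert Complex.exp_log h using 2
  push_cast; ring

lemma ne_zero_of_im {z : ℂ} (hz : 0 < z.im) : z ≠ 0 := by
  rintro rfl; simp at hz

lemma s_ne_zero {z : ℂ} (hz : 0 < z.im) : s z ≠ 0 := by
  intro h
  have := s_sq z (ne_zero_of_im hz)
  rw [h] at this
  simp [ne_zero_of_im hz] at this

/-- a primitive 24th root of unity -/
noncomputable def ze : ℂ := Complex.exp (2 * Real.pi * I / 24)

lemma ze_ne_zero : ze ≠ 0 := Complex.exp_ne_zero _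

lemma ze_twelve : ze ^ 12 = -1 := by
  rw [ze, ← Complex.exp_nat_mul, ← Complex.exp_pi_mul_I]
  congr 1; push_cast; ring

lemma sqrt_neg_I : Complex.sqrt (-I) * ze ^ 3 = 1 := by
  rw [sqrt_eq_exp (neg_ne_zero.2 I_ne_zero), Complex.log_neg_I, ze, ← Complex.exp_nat_mul,
    ← Complex.exp_add, ← Complex.exp_zero]
  congr 1; push_cast; ring

lemma sqrt_I : Complex.sqrt I = ze ^ 3 := by
  rw [sqrt_eq_exp (I_ne_zero), Complex.log_I, ze, ← Complex.exp_nat_mul]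
  congr 1; push_cast; ring

lemma s_eq {z : ℂ} (hz : 0 < z.im) : s z * ze ^ 3 = Complex.sqrt z := by
  have h := sqrt_mul_of_re (a := -I) (b := z) (neg_ne_zero.2 I_ne_zero) (ne_zero_of_im hz)
    (by simp) (Or.inr (by simpa using hz))
  rw [s, h]
  linear_combination Complex.sqrt z * sqrt_neg_I

lemma eta_S {z : ℂ} (hz : 0 < z.im) : η (-1 / z) = s z * η z := by
  have h := eta_comp_eq_csqrt_I_inv (x := z) hz
  simp only [Function.comp, Pi.smul_apply, Pi.mul_apply, smul_eq_mul] at h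
  rw [h, sqrt_I, ← s_eq hz]
  field_simp [ze_ne_zero]

lemma eta_T (z : ℂ) : η (z + 1) = ze * η z := by
  have h1 : Function.Periodic.qParam 24 (z + 1) = ze * Function.Periodic.qParam 24 z := by
    simp only [Function.Periodic.qParam, ze, ← Complex.exp_add]
    congr 1; push_cast; ring
  have h2 : ∀ n, eta_q n (z + 1) = eta_q n z := by
    intro n
    simp only [eta_q]
    congr 1
    simp only [Function.Periodic.qParam]
    rw [← Complex.exp_periodic (_ * z / _)]
    congr 1; push_cast; ring
  simp only [ModularForm.eta, h1, h2]
  ring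

lemma eta_T_nat (n : ℕ) (z : ℂ) : η (z + n) = ze ^ n * η z := by
  induction n with
  | zero => simp
  | succ n ih =>
    push_cast
    rw [← add_assoc, eta_T, ih]; ring

lemma eta_sub_nat (n : ℕ) (z : ℂ) : ze ^ n * η (z - n) = η z := by
  rw [← eta_T_nat]; simp

lemma im_S {z : ℂ} (hz : 0 < z.im) : 0 < (-1 / z).im := by
  rw [neg_div, one_div, Complex.neg_im, Complex.inv_im]
  have : 0 < Complex.normSq z := Complex.normSq_pos.2 (ne_zero_of_im hz)
  have := div_pos hz this
  rw [neg_div]; linarith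

/-- `k = 1` : -/
lemma eta_k1 {t : ℂ} (ht : 0 < t.im) :
    η ((-1 / t + 1) / 5) = - ze ^ 10 * s t * η ((t - 1) / 5) := by
  set w := (t - 1) / 5 with hw
  have hwi : 0 < w.im := by
    rw [hw, show (t - 1) / 5 = ((1/5 : ℝ) : ℂ) * (t - 1) by push_cast; ring, Complex.im_ofReal_mul]
    simpa using ht
  have hw0 := ne_zero_of_im hwi
  have ht0 := ne_zero_of_im ht
  have htw : t = 5 * w + 1 := by rw [hw]; ring
  have hu := im_S hwi
  have hu5 : 0 < (-1 / w - 5).im := by simpa using hu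
  have hx0 := ne_zero_of_im hu5
  have e1 : (-1 / t + 1) / 5 = -1 / (-1 / w - 5) := by
    have h2 : -1 / w - 5 = -t / w := by rw [htw]; field_simp; ring
    rw [h2]
    field_simp
    rw [htw]; ring
  have e2 := eta_sub_nat 5 (-1 / w)
  push_cast at e2
  rw [eta_S hwi] at e2
  have e3 : s (-1 / w - 5) * s w = s t * ze ^ 3 := by
    rw [s_eq ht, s, s, ← sqrt_mul_of_re]
    · congr 1
      rw [htw]; field_simp
      linear_combination (-1 - w * 5) * I_sq
    · exact mul_ne_zero (neg_ne_zero.2 I_ne_zero) hx0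
    · exact mul_ne_zero (neg_ne_zero.2 I_ne_zero) hw0
    · simpa using hu.le
    · left
      constructor
      · simpa using hwi.le
      · simpa using hu
  rw [e1, eta_S hu5]
  have := ze_ne_zero
  apply mul_left_cancel₀ (pow_ne_zero 5 this)
  linear_combination s (-1 / w - 5) * e2 + η w * e3 + s t * ze ^ 3 * η w * ze_twelve

/-- `k = 2` : -/
lemma eta_k2 {t : ℂ} (ht : 0 < t.im) :
    η ((-1 / t + 2) / 5) = s t * η ((t + 2) / 5) := by
  set w := (t + 2) / 5 with hw
  have hwi : 0 < w.im := by
    rw [hw, show (t + 2) / 5 = ((1/5 : ℝ) : ℂ) * (t + 2) by push_cast; ring, Complex.im_ofReal_mul]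
    simpa using ht
  have hw0 := ne_zero_of_im hwi
  have ht0 := ne_zero_of_im ht
  have htw : t = 5 * w - 2 := by rw [hw]; ring
  have hu := im_S hwi
  have hu2 : 0 < (-1 / w + 2).im := by simpa using hu
  have hu20 := ne_zero_of_im hu2
  have hy := im_S hu2
  have hx : 0 < (-1 / (-1 / w + 2) - 2).im := by simpa using hy
  have hx0 := ne_zero_of_im hx
  have hb0 : 1 - 2 * w ≠ 0 := by
    intro h
    have := congrArg Complex.im h
    simp at this; linarith
  have h2 : -1 / w + 2 = -(1 - 2 * w) / w := by field_simp; ring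
  have hx' : -1 / (-1 / w + 2) - 2 = t / (1 - 2 * w) := by
    rw [h2, htw]
    have : -(1 - 2 * w) ≠ 0 := neg_ne_zero.2 hb0
    field_simp; ring
  have e1 : (-1 / t + 2) / 5 = -1 / (-1 / (-1 / w + 2) - 2) := by
    rw [hx']
    field_simp
    rw [htw]; ring
  have e2 := eta_sub_nat 2 (-1 / (-1 / w + 2))
  have e4 := eta_T_nat 2 (-1 / w)
  push_cast at e2 e4
  rw [eta_S hwi] at e4
  rw [eta_S hu2, e4] at e2
  have e3 : s (-1 / w + 2) * s w = Complex.sqrt (1 - 2 * w) := by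
    rw [s, s, ← sqrt_mul_of_re]
    · congr 1
      field_simp
      linear_combination (-1 + 2 * w) * I_sq
    · exact mul_ne_zero (neg_ne_zero.2 I_ne_zero) hu20
    · exact mul_ne_zero (neg_ne_zero.2 I_ne_zero) hw0
    · simpa using hu.le
    · left
      constructor
      · simpa using hwi.le
      · simpa using hu
  have e5 : s (-1 / (-1 / w + 2) - 2) * Complex.sqrt (1 - 2 * w) = s t := by
    have e : (-I * (-1 / (-1 / w + 2) - 2)) * (1 - 2 * w) = -I * t := by
      rw [hx']; field_simp
    rw [s, s, ← sqrt_mul_of_re, e]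
    · exact mul_ne_zero (neg_ne_zero.2 I_ne_zero) hx0
    · exact hb0
    · simpa using hy.le
    · right
      rw [e]
      simpa using ht
  rw [e1, eta_S hx]
  have := ze_ne_zero
  apply mul_left_cancel₀ (pow_ne_zero 2 this)
  rw [← e5, ← e3]
  linear_combination s (-1 / (-1 / w + 2) - 2) * e2

/-- `k = -2` : -/
lemma eta_km2 {t : ℂ} (ht : 0 < t.im) :
    η ((-1 / t - 2) / 5) = s t * η ((t - 2) / 5) := by
  set w := (t - 2) / 5 with hw
  have hwi : 0 < w.im := by
    rw [hw, show (t - 2) / 5 = ((1/5 : ℝ) : ℂ) * (t - 2) by push_cast; ring, Complex.im_ofReal_mul]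
    simpa using ht
  have hw0 := ne_zero_of_im hwi
  have ht0 := ne_zero_of_im ht
  have htw : t = 5 * w + 2 := by rw [hw]; ring
  have hu := im_S hwi
  have hu2 : 0 < (-1 / w - 2).im := by simpa using hu
  have hu20 := ne_zero_of_im hu2
  have hy := im_S hu2
  have hx : 0 < (-1 / (-1 / w - 2) + 2).im := by simpa using hy
  have hx0 := ne_zero_of_im hx
  have hb0 : 1 + 2 * w ≠ 0 := by
    intro h
    have := congrArg Complex.im h
    simp at this; linarith
  have h2 : -1 / w - 2 = -(1 + 2 * w) / w := by field_simp; ring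
  have hx' : -1 / (-1 / w - 2) + 2 = t / (1 + 2 * w) := by
    rw [h2, htw]
    have : -(1 + 2 * w) ≠ 0 := neg_ne_zero.2 hb0
    field_simp; ring
  have e1 : (-1 / t - 2) / 5 = -1 / (-1 / (-1 / w - 2) + 2) := by
    rw [hx']
    field_simp
    rw [htw]; ring
  have e2 := eta_T_nat 2 (-1 / (-1 / w - 2))
  have e4 := eta_sub_nat 2 (-1 / w)
  push_cast at e2 e4
  rw [eta_S hwi] at e4
  rw [eta_S hu2] at e2
  have e3 : s (-1 / w - 2) * s w = Complex.sqrt (1 + 2 * w) := by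
    rw [s, s, ← sqrt_mul_of_re]
    · congr 1
      field_simp
      linear_combination (-1 - 2 * w) * I_sq
    · exact mul_ne_zero (neg_ne_zero.2 I_ne_zero) hu20
    · exact mul_ne_zero (neg_ne_zero.2 I_ne_zero) hw0
    · simpa using hu.le
    · left
      constructor
      · simpa using hwi.le
      · simpa using hu
  have e5 : s (-1 / (-1 / w - 2) + 2) * Complex.sqrt (1 + 2 * w) = s t := by
    have e : (-I * (-1 / (-1 / w - 2) + 2)) * (1 + 2 * w) = -I * t := by
      rw [hx']; field_simp
    rw [s, s, ← sqrt_mul_of_re, e]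
    · exact mul_ne_zero (neg_ne_zero.2 I_ne_zero) hx0
    · exact hb0
    · simpa using hy.le
    · right
      rw [e]
      simpa using ht
  rw [e1, eta_S hx, e2, ← e5, ← e3]
  linear_combination s (-1 / (-1 / w - 2) + 2) * s (-1 / w - 2) * e4

open scoped MatrixGroups UpperHalfPlane

lemma slash_S (G : ℂ → ℂ) (k : ℤ) (τ : ℍ) :
    ((fun τ : ℍ => G τ) ∣[k] ModularGroup.S) τ = G (-1 / (τ : ℂ)) * (τ : ℂ) ^ (-k) := by
  rw [SL_slash_apply, UpperHalfPlane.modular_S_smul, ModularGroup.denom_S]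
  congr 2
  change (-(τ : ℂ))⁻¹ = -1 / (τ : ℂ)
  rw [neg_div, one_div, inv_neg]

lemma slash_T (G : ℂ → ℂ) (k : ℤ) (τ : ℍ) :
    ((fun τ : ℍ => G τ) ∣[k] ModularGroup.T) τ = G (τ + 1) := by
  rw [SL_slash_apply, UpperHalfPlane.modular_T_smul]
  have : UpperHalfPlane.denom (ModularGroup.T : SL(2, ℤ)) τ = 1 := by
    rw [ModularGroup.denom_apply]; simp [ModularGroup.T]
  rw [this, one_zpow, mul_one]
  simp [add_comm]

lemma slash_all {X : Type} (act : X → SL(2, ℤ) → X) (h1 : ∀ x, act x 1 = x)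
    (hm : ∀ x g h, act x (g * h) = act (act x g) h) (k : ℤ) (F : X → ℍ → ℂ)
    (hS : ∀ x, F x ∣[k] ModularGroup.S = F (act x ModularGroup.S))
    (hT : ∀ x, F x ∣[k] ModularGroup.T = F (act x ModularGroup.T)) (γ : SL(2, ℤ)) :
    ∀ x, F x ∣[k] γ = F (act x γ) := by
  have hγ : γ ∈ Subgroup.closure {ModularGroup.S, ModularGroup.T} := by
    rw [SpecialLinearGroup.SL2Z_generators]; trivial
  induction hγ using Subgroup.closure_induction with
  | mem y hy =>
    rcases hy with rfl | rfl
    · exact hS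
    · exact hT
  | one => intro x; rw [SlashAction.slash_one, h1]
  | mul g h _ _ ihg ihh =>
    intro x
    rw [SlashAction.slash_mul, ihg, ihh, hm]
  | inv g _ ih =>
    intro x
    have := ih (act x g⁻¹)
    rw [← hm, inv_mul_cancel, h1] at this
    rw [← this, ← SlashAction.slash_mul, mul_inv_cancel, SlashAction.slash_one]

/-- right action on row vectors modulo `N` -/
def act {N : ℕ} (v : ZMod N × ZMod N) (g : SL(2, ℤ)) : ZMod N × ZMod N :=
  (v.1 * (g 0 0 : ℤ) + v.2 * (g 1 0 : ℤ), v.1 * (g 0 1 : ℤ) + v.2 * (g 1 1 : ℤ))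

lemma act_one {N : ℕ} (v : ZMod N × ZMod N) : act v 1 = v := by
  simp [act]

lemma act_mul {N : ℕ} (v : ZMod N × ZMod N) (g h : SL(2, ℤ)) :
    act v (g * h) = act (act v g) h := by
  simp only [act, Matrix.SpecialLinearGroup.coe_mul, Matrix.mul_apply, Fin.sum_univ_two]
  push_cast
  ext <;> simp only <;> ring

lemma act_S {N : ℕ} (v : ZMod N × ZMod N) : act v ModularGroup.S = (v.2, -v.1) := by
  simp [act, ModularGroup.S]

lemma act_T {N : ℕ} (v : ZMod N × ZMod N) : act v ModularGroup.T = (v.1, v.1 + v.2) := by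
  simp [act, ModularGroup.T]

lemma s_S {t : ℂ} (ht : 0 < t.im) : s (-1 / t) * s t = 1 := by
  have ht0 := ne_zero_of_im ht
  have h := im_S ht
  rw [s, s, ← sqrt_mul_of_re]
  · rw [← Complex.sqrt_one]
    congr 1
    field_simp
    simp
  · exact mul_ne_zero (neg_ne_zero.2 I_ne_zero) (ne_zero_of_im h)
  · exact mul_ne_zero (neg_ne_zero.2 I_ne_zero) ht0
  · simpa using h.le
  · left
    constructor
    · simpa using ht.le
    · simpa using h

/-! ### Level 5 -/

instance fact5 : Fact (Nat.Prime 5) := ⟨by norm_num⟩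

/-- quadratic character mod 5 -/
noncomputable def chi (n : ZMod 5) : ℂ := (quadraticChar (ZMod 5) n : ℤ)

lemma chi_mul (a b : ZMod 5) : chi (a * b) = chi a * chi b := by
  rw [chi, map_mul]; push_cast; rfl
lemma chi_zero : chi 0 = 0 := by simp [chi]
lemma chi_one : chi 1 = 1 := by simp [chi]
lemma chi_two : chi 2 = -1 := by
  have : quadraticChar (ZMod 5) 2 = -1 := by decide
  simp [chi, this]
lemma chi_three : chi 3 = -1 := by
  have : quadraticChar (ZMod 5) 3 = -1 := by decide
  simp [chi, this]
lemma chi_four : chi 4 = 1 := by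
  have : quadraticChar (ZMod 5) 4 = 1 := by decide
  simp [chi, this]
lemma chi_sq (a : ZMod 5) (ha : a ≠ 0) : chi a * chi a = 1 := by
  rw [← chi_mul, chi, ← sq, quadraticChar_sq_one' ha]; simp
lemma chi_neg (a : ZMod 5) : chi (-a) = chi a := by
  have : -a = 4 * a := by
    have h : (4 : ZMod 5) = -1 := by decide
    rw [h]; ring
  rw [this, chi_mul, chi_four, one_mul]

/-- the normalised conjugates of `η(5τ)` -/
noncomputable def E (n : ℕ) (t : ℂ) : ℂ := ze ^ (19 * n) * η ((t + n) / 5)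

lemma ze_24 : ze ^ 24 = 1 := by
  rw [show 24 = 12 * 2 from rfl, pow_mul, ze_twelve]; norm_num

lemma E_add_five (n : ℕ) (t : ℂ) : E (n + 5) t = E n t := by
  have h : (t + ((n + 5 : ℕ) : ℂ)) / 5 = (t + n) / 5 + 1 := by push_cast; ring
  rw [E, E, h, eta_T]
  have : ze ^ (19 * (n + 5)) * ze = ze ^ (19 * n) * (ze ^ 24) ^ 4 := by ring
  rw [ze_24, one_pow, mul_one] at this
  rw [← this]; ring

lemma E_succ (n : ZMod 5) (t : ℂ) : E (n + 1).val t = E (n.val + 1) t := by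
  fin_cases n
  · rfl
  · rfl
  · rfl
  · rfl
  · exact (E_add_five 0 t).symm

lemma E_T (n : ℕ) (t : ℂ) : E n (t + 1) = ze ^ 5 * E (n + 1) t := by
  have h : (t + 1 + n) / 5 = (t + ((n + 1 : ℕ) : ℂ)) / 5 := by push_cast; ring
  rw [E, E, h]
  have : ze ^ 5 * ze ^ (19 * (n + 1)) = ze ^ (19 * n) * ze ^ 24 := by ring
  rw [ze_24] at this
  linear_combination - this * η ((t + ((n + 1 : ℕ) : ℂ)) / 5)

lemma E_S1 {t : ℂ} (ht : 0 < t.im) : E 1 (-1 / t) = - s t * E 4 t := by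
  have h := eta_k1 ht
  have h2 := eta_T ((t - 1) / 5)
  rw [show (t - 1) / 5 + 1 = (t + 4) / 5 by ring] at h2
  simp only [E]
  push_cast
  rw [h, h2]
  linear_combination (s t * ze ^ 29 * η ((t - 1) / 5) * (1 + ze ^ 24)) * ze_24

lemma E_S {t : ℂ} (ht : 0 < t.im) (n : ZMod 5) (hn : n ≠ 0) :
    E n.val (-1 / t) = - chi n * s t * E (-n⁻¹).val t := by
  have hcases : ∀ n : ZMod 5, n ≠ 0 → n = 1 ∨ n = 2 ∨ n = 3 ∨ n = 4 := by decide
  have hi1 : -(1 : ZMod 5)⁻¹ = 4 := by rw [inv_one]; decide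
  have hi2 : -(2 : ZMod 5)⁻¹ = 2 := by
    rw [inv_eq_of_mul_eq_one_right (b := 3) (by decide)]; decide
  have hi3 : -(3 : ZMod 5)⁻¹ = 3 := by
    rw [inv_eq_of_mul_eq_one_right (b := 2) (by decide)]; decide
  have hi4 : -(4 : ZMod 5)⁻¹ = 1 := by
    rw [inv_eq_of_mul_eq_one_right (b := 4) (by decide)]; decide
  rcases hcases n hn with rfl | rfl | rfl | rfl
  · rw [hi1]
    change E 1 (-1 / t) = - chi 1 * s t * E 4 t
    rw [chi_one, E_S1 ht]; ring
  · rw [hi2]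
    change E 2 (-1 / t) = - chi 2 * s t * E 2 t
    rw [chi_two]
    simp only [E]
    push_cast
    rw [eta_k2 ht]; ring
  · rw [hi3]
    change E 3 (-1 / t) = - chi 3 * s t * E 3 t
    rw [chi_three]
    simp only [E]
    push_cast
    rw [show (-1 / t + 3) / 5 = (-1 / t - 2) / 5 + 1 by ring,
      show (t + 3) / 5 = (t - 2) / 5 + 1 by ring, eta_T, eta_T, eta_km2 ht]
    ring
  · rw [hi4]
    change E 4 (-1 / t) = - chi 4 * s t * E 1 t
    rw [chi_four]
    have h := E_S1 (im_S ht)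
    rw [show -1 / (-1 / t) = t by have := ne_zero_of_im ht; field_simp] at h
    rw [h]
    linear_combination - E 4 (-1 / t) * s_S ht

/-- the conjugates of `η(5τ)/η(τ)⁵` -/
noncomputable def G5 (v : ZMod 5 × ZMod 5) (t : ℂ) : ℂ :=
  if v.1 = 0 then chi v.2 * η (5 * t) / η t ^ 5
  else - chi v.1 * ((Real.sqrt 5 : ℝ) : ℂ)⁻¹ * E (v.2 / v.1).val t / η t ^ 5

lemma sqrt5_sq : ((Real.sqrt 5 : ℝ) : ℂ) ^ 2 = 5 := by
  rw [← Complex.ofReal_pow, Real.sq_sqrt (by norm_num)]; simp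

lemma sqrt5_ne : ((Real.sqrt 5 : ℝ) : ℂ) ≠ 0 := by
  intro h
  have := sqrt5_sq
  rw [h] at this; norm_num at this

lemma s_five {t : ℂ} (ht : 0 < t.im) : s t = ((Real.sqrt 5 : ℝ) : ℂ) * s (t / 5) := by
  have ht0 := ne_zero_of_im ht
  have ht5 : 0 < (t / 5).im := by
    rw [show t / 5 = ((1/5 : ℝ) : ℂ) * t by push_cast; ring, Complex.im_ofReal_mul]
    linarith
  have h5 : ((Real.sqrt 5 : ℝ) : ℂ) = Complex.sqrt 5 := by
    rw [Real.sqrt_eq_rpow, Complex.sqrt, Complex.ofReal_cpow (by norm_num)]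
    norm_num
  rw [h5, s, s, ← sqrt_mul_of_re]
  · congr 1; ring
  · norm_num
  · exact mul_ne_zero (neg_ne_zero.2 I_ne_zero) (ne_zero_of_im ht5)
  · norm_num
  · left
    constructor
    · simpa using ht5.le
    · norm_num

lemma s_five' {t : ℂ} (ht : 0 < t.im) : s (5 * t) = ((Real.sqrt 5 : ℝ) : ℂ) * s t := by
  have : 0 < (5 * t).im := by simpa using ht
  rw [s_five this]
  congr 2; ring

lemma G5_S (v : ZMod 5 × ZMod 5) {t : ℂ} (ht : 0 < t.im) :
    G5 v (-1 / t) * t ^ 2 = G5 (v.2, -v.1) t := by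
  have ht0 := ne_zero_of_im ht
  have hs0 := s_ne_zero ht
  have hη : η t ≠ 0 := eta_ne_zero ht
  have ht5 : 0 < (t / 5).im := by
    rw [show t / 5 = ((1/5 : ℝ) : ℂ) * t by push_cast; ring, Complex.im_ofReal_mul]
    linarith
  have hs4 : s t ^ 4 = - t ^ 2 := by
    rw [show s t ^ 4 = (s t ^ 2) ^ 2 by ring, s_sq t ht0]
    linear_combination t ^ 2 * I_sq
  have h5 := sqrt5_ne
  obtain ⟨c, d⟩ := v
  simp only [G5]
  rw [eta_S ht]
  by_cases hc : c = 0
  · subst hc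
    by_cases hd : d = 0
    · subst hd; simp [chi_zero]
    · simp only [if_true, hd, if_false, neg_zero, zero_div, ZMod.val_zero, E]
      rw [show 5 * (-1 / t) = -1 / (t / 5) by field_simp, eta_S ht5]
      have := s_five ht
      simp only [mul_zero, pow_zero, Nat.cast_zero, add_zero, one_mul]
      have e : s (t / 5) = s t * ((Real.sqrt 5 : ℝ) : ℂ)⁻¹ := by
        rw [this]; field_simp
      rw [e]
      field_simp
      rw [hs4]; ring
  · by_cases hd : d = 0
    · subst hd
      simp only [hc, if_true, if_false, zero_div, ZMod.val_zero, E, chi_neg]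
      simp only [mul_zero, pow_zero, Nat.cast_zero, add_zero, one_mul]
      have ht5' : 0 < (5 * t).im := by simpa using ht
      rw [show -1 / t / 5 = -1 / (5 * t) by field_simp, eta_S ht5', s_five' ht]
      field_simp
      rw [hs4]; ring
    · have hn : d / c ≠ 0 := div_ne_zero hd hc
      simp only [hc, hd, if_false]
      rw [E_S ht _ hn]
      have e1 : -(d / c)⁻¹ = -c / d := by field_simp
      have e2 : chi c * chi (d / c) = chi d := by rw [← chi_mul]; congr 1; field_simp
      rw [e1, ← e2]
      field_simp
      rw [hs4]; ring

lemma G5_T (v : ZMod 5 × ZMod 5) {t : ℂ} (ht : 0 < t.im) :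
    G5 v (t + 1) = G5 (v.1, v.1 + v.2) t := by
  have hη : η t ≠ 0 := eta_ne_zero ht
  have hz := ze_ne_zero
  obtain ⟨c, d⟩ := v
  simp only [G5]
  rw [eta_T]
  by_cases hc : c = 0
  · subst hc
    have := eta_T_nat 5 (5 * t)
    push_cast at this
    simp only [if_true, zero_add]
    rw [mul_add, mul_one, this]
    field_simp
  · simp only [hc, if_false]
    rw [E_T, ← E_succ, show d / c + 1 = (c + d) / c by field_simp; ring]
    field_simp

lemma G5_slash (γ : SL(2, ℤ)) (v : ZMod 5 × ZMod 5) :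
    (fun τ : ℍ => G5 v τ) ∣[(-2 : ℤ)] γ = fun τ : ℍ => G5 (act v γ) τ := by
  refine slash_all act act_one act_mul (-2) (fun v (τ : ℍ) => G5 v τ) ?_ ?_ γ v
  · intro v
    ext τ
    rw [slash_S (G5 v), act_S, ← G5_S v τ.im_pos]
    rfl
  · intro v
    ext τ
    rw [slash_T (G5 v), act_T, ← G5_T v τ.im_pos]

/-! ### Level 2 -/

/-- the conjugates of `η(2τ)⁸/η(τ)¹⁶` -/
noncomputable def G2 (v : ZMod 2 × ZMod 2) (t : ℂ) : ℂ :=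
  if v.1 = 0 then (if v.2 = 0 then 0 else η (2 * t) ^ 8 / η t ^ 16)
  else if v.2 = 0 then η (t / 2) ^ 8 / (16 * η t ^ 16)
  else ze ^ 8 * η ((t + 1) / 2) ^ 8 / (16 * η t ^ 16)

lemma eta_S8 {t : ℂ} (ht : 0 < t.im) : η (-1 / t) ^ 8 = t ^ 4 * η t ^ 8 := by
  rw [eta_S ht, mul_pow, show s t ^ 8 = (s t ^ 2) ^ 4 by ring, s_sq t (ne_zero_of_im ht)]
  linear_combination t ^ 4 * η t ^ 8 * I_pow_four

lemma eta_half {t : ℂ} (ht : 0 < t.im) :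
    η ((-1 / t + 1) / 2) ^ 8 = t ^ 4 * η ((t + 1) / 2) ^ 8 := by
  set w := (t - 1) / 2 with hw
  have hwi : 0 < w.im := by
    rw [hw, show (t - 1) / 2 = ((1/2 : ℝ) : ℂ) * (t - 1) by push_cast; ring, Complex.im_ofReal_mul]
    simpa using ht
  have hw0 := ne_zero_of_im hwi
  have ht0 := ne_zero_of_im ht
  have htw : t = 2 * w + 1 := by rw [hw]; ring
  have hu := im_S hwi
  have hu5 : 0 < (-1 / w - 2).im := by simpa using hu
  have h2 : -1 / w - 2 = -t / w := by rw [htw]; field_simp; ring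
  have e1 : (-1 / t + 1) / 2 = -1 / (-1 / w - 2) := by
    rw [h2]
    field_simp
    rw [htw]; ring
  have e2 := eta_sub_nat 2 (-1 / w)
  push_cast at e2
  have e3 := eta_T w
  rw [show w + 1 = (t + 1) / 2 by rw [hw]; ring] at e3
  have e4 : (ze ^ 2 * η (-1 / w - 2)) ^ 8 = w ^ 4 * η w ^ 8 := by rw [e2, eta_S8 hwi]
  rw [e1, eta_S8 hu5, e3, h2]
  rw [h2] at e4
  apply mul_left_cancel₀ (pow_ne_zero 16 ze_ne_zero)
  generalize η (-t / w) = X at *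
  generalize η w = Y at *
  rw [div_pow]
  field_simp
  linear_combination e4 - w ^ 4 * Y ^ 8 * ze_24

lemma G2_S (v : ZMod 2 × ZMod 2) {t : ℂ} (ht : 0 < t.im) :
    G2 v (-1 / t) * t ^ 4 = G2 (v.2, -v.1) t := by
  have ht0 := ne_zero_of_im ht
  have hη : η t ≠ 0 := eta_ne_zero ht
  have ht2 : 0 < (t / 2).im := by
    rw [show t / 2 = ((1/2 : ℝ) : ℂ) * t by push_cast; ring, Complex.im_ofReal_mul]
    linarith
  have ht2' : 0 < (2 * t).im := by simpa using ht
  obtain ⟨c, d⟩ := v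
  have hcd : ∀ x : ZMod 2, x = 0 ∨ x = 1 := by decide
  have h16 : η (-1 / t) ^ 16 = t ^ 8 * η t ^ 16 := by
    rw [show η (-1 / t) ^ 16 = (η (-1 / t) ^ 8) ^ 2 by ring, eta_S8 ht]; ring
  simp only [G2]
  rw [h16]
  rcases hcd c with rfl | rfl <;> rcases hcd d with rfl | rfl
  · simp
  · simp only [if_true, one_ne_zero, if_false, neg_zero]
    rw [show 2 * (-1 / t) = -1 / (t / 2) by field_simp, eta_S8 ht2]
    field_simp; ring
  · simp only [if_true, one_ne_zero, if_false, neg_eq_zero]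
    rw [show -1 / t / 2 = -1 / (2 * t) by field_simp, eta_S8 ht2']
    field_simp; ring
  · simp only [one_ne_zero, if_false, neg_eq_zero]
    rw [eta_half ht]
    field_simp

lemma G2_T (v : ZMod 2 × ZMod 2) {t : ℂ} (ht : 0 < t.im) :
    G2 v (t + 1) = G2 (v.1, v.1 + v.2) t := by
  have hη : η t ≠ 0 := eta_ne_zero ht
  have hz := ze_ne_zero
  obtain ⟨c, d⟩ := v
  have hcd : ∀ x : ZMod 2, x = 0 ∨ x = 1 := by decide
  have h11 : (1 + 1 : ZMod 2) = 0 := by decide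
  simp only [G2]
  rw [eta_T]
  rcases hcd c with rfl | rfl <;> rcases hcd d with rfl | rfl
  · simp
  · have := eta_T_nat 2 (2 * t)
    push_cast at this
    simp only [if_true, one_ne_zero, if_false, zero_add]
    rw [mul_add, mul_one, this]
    field_simp
  · simp only [if_true, one_ne_zero, if_false, add_zero]
    field_simp
    linear_combination - η ((t + 1) / 2) ^ 8 * ze_24
  · simp only [if_true, one_ne_zero, if_false, h11]
    rw [show (t + 1 + 1) / 2 = t / 2 + 1 by ring, eta_T]
    field_simp

lemma G2_slash (γ : SL(2, ℤ)) (v : ZMod 2 × ZMod 2) :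
    (fun τ : ℍ => G2 v τ) ∣[(-4 : ℤ)] γ = fun τ : ℍ => G2 (act v γ) τ := by
  refine slash_all act act_one act_mul (-4) (fun v (τ : ℍ) => G2 v τ) ?_ ?_ γ v
  · intro v
    ext τ
    rw [slash_S (G2 v), act_S, ← G2_S v τ.im_pos]
    rfl
  · intro v
    ext τ
    rw [slash_T (G2 v), act_T, ← G2_T v τ.im_pos]

/-! ### `η¹²` -/

/-- the sign character of `SL₂(𝔽₂)` -/
def sg (m : SL(2, ZMod 2)) : ℤ := if m = 1 ∨ m 0 0 + m 1 1 = 1 then 1 else -1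

/-- reduction mod 2 -/
def red (g : SL(2, ℤ)) : SL(2, ZMod 2) :=
  Matrix.SpecialLinearGroup.map (Int.castRingHom (ZMod 2)) g

lemma sg_S : ∀ m : SL(2, ZMod 2), sg (m * red ModularGroup.S) = - sg m := by decide

lemma sg_T : ∀ m : SL(2, ZMod 2), sg (m * red ModularGroup.T) = - sg m := by decide

lemma eta12_slash (γ : SL(2, ℤ)) (m : SL(2, ZMod 2)) :
    (fun τ : ℍ => (sg m : ℂ) * η (τ : ℂ) ^ 12) ∣[(6 : ℤ)] γ =
      fun τ : ℍ => (sg (m * red γ) : ℂ) * η (τ : ℂ) ^ 12 := by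
  refine slash_all (fun m γ => m * red γ) (by intro x; simp [red])
    (by intro x g h; simp [red, mul_assoc]) 6
    (fun m (τ : ℍ) => (sg m : ℂ) * η (τ : ℂ) ^ 12) ?_ ?_ γ m
  · intro m
    ext τ
    rw [slash_S (fun t => (sg m : ℂ) * η t ^ 12), sg_S, eta_S τ.im_pos, mul_pow,
      show s τ ^ 12 = (s τ ^ 2) ^ 6 by ring, s_sq _ τ.ne_zero]
    have := τ.ne_zero
    have hI : (-I * (τ : ℂ)) ^ 6 = - (τ : ℂ) ^ 6 := by
      linear_combination (τ : ℂ) ^ 6 * (I ^ 4 - I ^ 2 + 1) * I_sq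
    rw [hI, zpow_neg]
    push_cast
    have h6 : (τ : ℂ) ^ (6 : ℤ) = (τ : ℂ) ^ (6 : ℕ) := by norm_cast
    rw [h6]
    field_simp
  · intro m
    ext τ
    rw [slash_T (fun t => (sg m : ℂ) * η t ^ 12), sg_T, eta_T, mul_pow, ze_twelve]
    push_cast; ring

/-! ### The function `U` -/

lemma eta_qPoch (k : ℕ) (τ : ℍ) :
    η (k * (τ : ℂ)) = Complex.exp (Real.pi * I * τ / 12) ^ k * qPoch (Qc τ ^ k) (Qc τ ^ k) := by
  rw [ModularForm.eta, qPoch]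
  congr 1
  · rw [← Complex.exp_nat_mul, Function.Periodic.qParam]
    congr 1; push_cast; ring
  · congr 1
    ext n
    have hk : Complex.exp (2 * Real.pi * I * (k * (τ : ℂ))) = Qc τ ^ k := by
      rw [Qc, ← Complex.exp_nat_mul]
      congr 1; ring
    rw [eta_q_eq_pow, hk, ← pow_succ']

lemma U_eta (τ : ℍ) : Ufun τ = η τ * η (10 * τ) ^ 2 / (η (2 * τ) ^ 2 * η (5 * τ)) := by
  have h1 := eta_qPoch 1 τ
  have h2 := eta_qPoch 2 τ
  have h5 := eta_qPoch 5 τ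
  have h10 := eta_qPoch 10 τ
  have e : Complex.exp (Real.pi * I * τ) = Complex.exp (Real.pi * I * τ / 12) ^ 12 := by
    rw [← Complex.exp_nat_mul]; congr 1; push_cast; ring
  have e0 := Complex.exp_ne_zero (Real.pi * I * τ / 12)
  push_cast at h1 h2 h5 h10
  rw [one_mul, pow_one, pow_one] at h1
  rw [h1, h2, h5, h10, Ufun, e]
  generalize Complex.exp (Real.pi * I * τ / 12) = x at *
  rw [show x * qPoch (Qc τ) (Qc τ) * (x ^ 10 * qPoch (Qc τ ^ 10) (Qc τ ^ 10)) ^ 2 =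
    x ^ 9 * (x ^ 12 * (qPoch (Qc τ) (Qc τ) * qPoch (Qc τ ^ 10) (Qc τ ^ 10) ^ 2)) by ring,
    show (x ^ 2 * qPoch (Qc τ ^ 2) (Qc τ ^ 2)) ^ 2 * (x ^ 5 * qPoch (Qc τ ^ 5) (Qc τ ^ 5)) =
    x ^ 9 * (qPoch (Qc τ ^ 2) (Qc τ ^ 2) ^ 2 * qPoch (Qc τ ^ 5) (Qc τ ^ 5)) by ring,
    mul_div_mul_left _ _ (pow_ne_zero 9 e0)]

lemma U_G (τ : ℍ) : Ufun τ =
    G5 (0, 1) (dbl τ) ^ 2 / G5 (0, 1) τ * G2 (0, 1) τ * η τ ^ 12 := by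
  have hd : ((dbl τ : ℍ) : ℂ) = 2 * τ := rfl
  have im : 0 < (τ : ℂ).im := τ.im_pos
  have n1 : η (τ : ℂ) ≠ 0 := eta_ne_zero im
  have n2 : η (2 * τ : ℂ) ≠ 0 := eta_ne_zero (show 0 < (2 * τ : ℂ).im by simpa using im)
  have n5 : η (5 * τ : ℂ) ≠ 0 := eta_ne_zero (show 0 < (5 * τ : ℂ).im by simpa using im)
  rw [U_eta, hd]
  simp only [G5, G2, if_true, one_ne_zero, if_false, chi_one, one_mul]
  rw [show 5 * (2 * (τ : ℂ)) = 10 * τ by ring]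
  field_simp

lemma G5_d (d : ZMod 5) (t : ℂ) : G5 (0, d) t = chi d * G5 (0, 1) t := by
  simp only [G5, if_true, chi_one]; ring

lemma jacobi_chi (d : ℤ) (hd : Odd d) : (jacobiSym 5 d.natAbs : ℂ) = chi d := by
  have h1 : jacobiSym 5 d.natAbs = jacobiSym d.natAbs 5 :=
    jacobiSym.quadratic_reciprocity_one_mod_four (a := 5) (by norm_num) (Int.natAbs_odd.2 hd)
  have h2 : (jacobiSym (d.natAbs : ℤ) 5 : ℂ) = chi ((d.natAbs : ℤ) : ZMod 5) := by
    rw [← jacobiSym.legendreSym.to_jacobiSym]; rfl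
  rw [h1, h2]
  rcases Int.natAbs_eq d with h | h
  · rw [← h]
  · conv_rhs => rw [h]
    push_cast
    rw [chi_neg]

lemma dbl_smul (γ γ' : SL(2, ℤ)) (h00 : γ' 0 0 = γ 0 0) (h01 : γ' 0 1 = 2 * γ 0 1)
    (h10 : 2 * γ' 1 0 = γ 1 0) (h11 : γ' 1 1 = γ 1 1) (τ : ℍ) :
    dbl (γ • τ) = γ' • dbl τ ∧
      UpperHalfPlane.denom γ' (dbl τ) = UpperHalfPlane.denom γ τ := by
  have hd : ((dbl τ : ℍ) : ℂ) = 2 * τ := rfl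
  have hd' : ((dbl (γ • τ) : ℍ) : ℂ) = 2 * ((γ • τ : ℍ) : ℂ) := rfl
  constructor
  · apply UpperHalfPlane.ext
    rw [hd', UpperHalfPlane.coe_specialLinearGroup_apply,
      UpperHalfPlane.coe_specialLinearGroup_apply, hd, h00, h01, h11, ← h10]
    simp only [algebraMap_int_eq, eq_intCast]
    push_cast
    ring
  · rw [ModularGroup.denom_apply, ModularGroup.denom_apply, hd, h11, ← h10]
    push_cast; ring

lemma G5_apply (γ : SL(2, ℤ)) (h : (5 : ℤ) ∣ γ 1 0) (τ : ℍ) :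
    G5 (0, 1) ((γ • τ : ℍ) : ℂ) * UpperHalfPlane.denom γ τ ^ 2 =
      chi (γ 1 1 : ℤ) * G5 (0, 1) τ := by
  have := congrFun (G5_slash γ (0, 1)) τ
  rw [SL_slash_apply] at this
  have hc : ((γ 1 0 : ℤ) : ZMod 5) = 0 := (ZMod.intCast_zmod_eq_zero_iff_dvd _ 5).2 h
  simp only [act, hc, zero_mul, one_mul, zero_add] at this
  exact this.trans (G5_d _ _)

lemma G2_apply (γ : SL(2, ℤ)) (h : (2 : ℤ) ∣ γ 1 0) (hd : Odd (γ 1 1)) (τ : ℍ) :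
    G2 (0, 1) ((γ • τ : ℍ) : ℂ) * UpperHalfPlane.denom γ τ ^ 4 = G2 (0, 1) τ := by
  have := congrFun (G2_slash γ (0, 1)) τ
  rw [SL_slash_apply] at this
  have hc : ((γ 1 0 : ℤ) : ZMod 2) = 0 := (ZMod.intCast_zmod_eq_zero_iff_dvd _ 2).2 h
  have hd' : ((γ 1 1 : ℤ) : ZMod 2) = 1 := ZMod.intCast_eq_one_iff_odd.2 hd
  simp only [act, hc, hd', zero_mul, one_mul, zero_add] at this
  exact this

lemma eta12_apply (γ : SL(2, ℤ)) (hb : (2 : ℤ) ∣ γ 0 1) (h : (2 : ℤ) ∣ γ 1 0)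
    (ha : Odd (γ 0 0)) (hd : Odd (γ 1 1)) (τ : ℍ) :
    η ((γ • τ : ℍ) : ℂ) ^ 12 = UpperHalfPlane.denom γ τ ^ 6 * η τ ^ 12 := by
  have := congrFun (eta12_slash γ 1) τ
  rw [SL_slash_apply] at this
  have hr : red γ = 1 := by
    ext i j
    have hb' : ((γ 0 1 : ℤ) : ZMod 2) = 0 := (ZMod.intCast_zmod_eq_zero_iff_dvd _ 2).2 hb
    have hc : ((γ 1 0 : ℤ) : ZMod 2) = 0 := (ZMod.intCast_zmod_eq_zero_iff_dvd _ 2).2 h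
    have hd' : ((γ 1 1 : ℤ) : ZMod 2) = 1 := ZMod.intCast_eq_one_iff_odd.2 hd
    have ha' : ((γ 0 0 : ℤ) : ZMod 2) = 1 := ZMod.intCast_eq_one_iff_odd.2 ha
    fin_cases i <;> fin_cases j <;> simp [red, *]
  have h1 : sg 1 = 1 := by decide
  simp only [hr, mul_one, h1, Int.cast_one, one_mul] at this
  have hden := UpperHalfPlane.denom_ne_zero γ τ
  rw [← this, zpow_neg]
  have h6 : UpperHalfPlane.denom γ τ ^ (6 : ℤ) = UpperHalfPlane.denom γ τ ^ (6 : ℕ) := by norm_cast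
  rw [h6]
  field_simp

end UEta

/-- `τ ↦ U(2τ)` is modular on `Γ₀(20)` with character `(5/·)`: for every
`γ = [a b; c d] ∈ SL₂(ℤ)` with `20 ∣ c` and every `τ ∈ ℍ`, one has
`U(2·γτ) = (5/d)·U(2τ)`, where `(5/d)` is the Jacobi (Legendre) symbol. -/
theorem statement8 (γ : Matrix.SpecialLinearGroup (Fin 2) ℤ) (hγ : (20 : ℤ) ∣ γ 1 0)
    (τ : UpperHalfPlane) :
    Ufun (dbl (γ • τ)) = (jacobiSym 5 (γ 1 1).natAbs : ℂ) * Ufun (dbl τ) := by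
  obtain ⟨m, hm⟩ := hγ
  have hdet : γ 0 0 * γ 1 1 - γ 0 1 * γ 1 0 = 1 := by
    have := γ.2; rwa [Matrix.det_fin_two] at this
  have hprod : Odd (γ 0 0 * γ 1 1) := by
    rw [hm] at hdet
    exact ⟨10 * (γ 0 1 * m), by linarith⟩
  obtain ⟨ha, hd⟩ := Int.odd_mul.1 hprod
  let γ' : Matrix.SpecialLinearGroup (Fin 2) ℤ :=
    ⟨!![γ 0 0, 2 * γ 0 1; 10 * m, γ 1 1], by
      rw [Matrix.det_fin_two_of]; rw [hm] at hdet; linarith⟩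
  let γ'' : Matrix.SpecialLinearGroup (Fin 2) ℤ :=
    ⟨!![γ 0 0, 4 * γ 0 1; 5 * m, γ 1 1], by
      rw [Matrix.det_fin_two_of]; rw [hm] at hdet; linarith⟩
  have a1 : γ' 0 0 = γ 0 0 := rfl
  have a2 : γ' 0 1 = 2 * γ 0 1 := rfl
  have a3 : γ' 1 0 = 10 * m := rfl
  have a4 : γ' 1 1 = γ 1 1 := rfl
  have b1 : γ'' 0 0 = γ 0 0 := rfl
  have b2 : γ'' 0 1 = 4 * γ 0 1 := rfl
  have b3 : γ'' 1 0 = 5 * m := rfl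
  have b4 : γ'' 1 1 = γ 1 1 := rfl
  obtain ⟨s1, d1⟩ := UEta.dbl_smul γ γ' a1 a2 (by rw [a3, hm]; ring) a4 τ
  obtain ⟨s2, d2⟩ := UEta.dbl_smul γ' γ'' (by rw [b1, a1]) (by rw [b2, a2]; ring)
    (by rw [a3, b3]; ring) (by rw [b4, a4]) (dbl τ)
  have k1 := UEta.G5_apply γ' ⟨2 * m, by rw [a3]; ring⟩ (dbl τ)
  have k2 := UEta.G5_apply γ'' ⟨m, by rw [b3]⟩ (dbl (dbl τ))
  have k3 := UEta.G2_apply γ' ⟨5 * m, by rw [a3]; ring⟩ (by rw [a4]; exact hd) (dbl τ)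
  have k4 := UEta.eta12_apply γ' ⟨γ 0 1, a2⟩ ⟨5 * m, by rw [a3]; ring⟩
    (by rw [a1]; exact ha) (by rw [a4]; exact hd) (dbl τ)
  have hJ := UpperHalfPlane.denom_ne_zero γ' (dbl τ)
  have hχ0 : ((γ 1 1 : ℤ) : ZMod 5) ≠ 0 := by
    intro h0
    have hz : ((γ 0 0 * γ 1 1 - γ 0 1 * γ 1 0 : ℤ) : ZMod 5) = 1 := by rw [hdet]; simp
    have h20 : ((20 : ℤ) : ZMod 5) = 0 := by decide
    rw [hm] at hz
    push_cast at hz h20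
    rw [h0, h20] at hz
    simp at hz
  have hχ := UEta.chi_sq _ hχ0
  rw [UEta.jacobi_chi _ hd, UEta.U_G (dbl τ), s1, UEta.U_G, s2, k4]
  rw [d2] at k2
  rw [a4] at k1
  rw [b4] at k2
  generalize UpperHalfPlane.denom γ' (dbl τ) = J at *
  generalize UEta.chi ((γ 1 1 : ℤ) : ZMod 5) = χ at *
  have hχ1 : χ ≠ 0 := by rintro rfl; simp at hχ
  rw [← eq_div_iff (pow_ne_zero _ hJ)] at k1 k2 k3
  rw [k1, k2, k3]
  by_cases hG : UEta.G5 (0, 1) (dbl τ) = 0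
  · rw [hG]; simp
  · field_simp
end

section
/- For every τ ∈ ℍ, the identities I(τ)⁴ + 1/J(τ)⁴ = 1/U(τ)² − 2 + 3U(τ)² and J(τ)⁴ + 1/I(τ)⁴ = 1/U(τ)⁶ − 2/U(τ)⁴ + 3/U(τ)² hold. -/
open Complex

/-- `U(τ) = I(τ)/J(τ)`. -/
noncomputable def UIJ (τ : UpperHalfPlane) : ℂ := Ifun τ / Jfun τ

open Filter Topology

namespace TriProd

/-- Gaussian binomial coefficients. -/
noncomputable def gb (p : ℂ) : ℕ → ℕ → ℂ
  | _, 0 => 1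
  | 0, _ + 1 => 0
  | N + 1, i + 1 => gb p N (i + 1) + p ^ (N - i) * gb p N i

/-- Finite product `(p;p)_N`. -/
noncomputable def fp (p : ℂ) (N : ℕ) : ℂ := ∏ k ∈ Finset.range N, (1 - p ^ (k + 1))

lemma gb_zero (p : ℂ) (N : ℕ) : gb p N 0 = 1 := by cases N <;> rfl

lemma gb_succ (p : ℂ) (N i : ℕ) :
    gb p (N + 1) (i + 1) = gb p N (i + 1) + p ^ (N - i) * gb p N i := rfl

lemma gb_of_lt (p : ℂ) : ∀ N i : ℕ, N < i → gb p N i = 0 := by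
  intro N
  induction N with
  | zero => intro i hi; obtain ⟨j, rfl⟩ : ∃ j, i = j + 1 := ⟨i - 1, by omega⟩; rfl
  | succ N ih =>
    intro i hi
    obtain ⟨j, rfl⟩ : ∃ j, i = j + 1 := ⟨i - 1, by omega⟩
    rw [gb_succ, ih _ (by omega), ih _ (by omega)]; simp

lemma fp_succ (p : ℂ) (N : ℕ) : fp p (N + 1) = fp p N * (1 - p ^ (N + 1)) := by
  simp [fp, Finset.prod_range_succ]

lemma gb_mul (p : ℂ) : ∀ N i j : ℕ, i + j = N → gb p N i * fp p i * fp p j = fp p N := by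
  intro N
  induction N with
  | zero =>
    intro i j h
    obtain rfl : i = 0 := by omega
    obtain rfl : j = 0 := by omega
    simp [gb_zero, fp]
  | succ N ih =>
    intro i j h
    cases i with
    | zero =>
      obtain rfl : j = N + 1 := by omega
      simp [gb_zero, fp]
    | succ i =>
      cases j with
      | zero =>
        obtain rfl : i = N := by omega
        have := ih i 0 rfl
        rw [gb_succ, gb_of_lt _ _ _ (Nat.lt_succ_self _), fp_succ]
        simp only [Nat.sub_self, pow_zero] 
        linear_combination (1 - p ^ (i + 1)) * this
      | succ j =>
        have h1 := ih (i + 1) j (by omega)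
        have h2 := ih i (j + 1) (by omega)
        have h3 : N - i = j + 1 := by omega
        have h4 : p ^ (N + 1) = p ^ (i + 1) * p ^ (j + 1) := by
          rw [← pow_add]; congr 1; omega
        rw [gb_succ, h3, fp_succ p N, h4]
        rw [fp_succ p j] at h2 ⊢
        rw [fp_succ p i] at h1 ⊢
        linear_combination (1 - p ^ (j + 1)) * h1 + p ^ (j + 1) * (1 - p ^ (i + 1)) * h2

lemma qbin (p x : ℂ) (N : ℕ) : ∏ k ∈ Finset.range N, (1 - x * p ^ k) =
    ∑ i ∈ Finset.range (N + 1), gb p N i * ((-1) ^ i * p ^ (i.choose 2) * x ^ i) := by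
  induction N with
  | zero => simp [gb_zero]
  | succ N ih =>
    rw [Finset.prod_range_succ, ih, Finset.sum_range_succ' _ (N + 1)]
    have e1 : ∀ i ∈ Finset.range (N + 1),
        gb p (N + 1) (i + 1) * ((-1) ^ (i + 1) * p ^ ((i + 1).choose 2) * x ^ (i + 1)) =
        gb p N (i + 1) * ((-1) ^ (i + 1) * p ^ ((i + 1).choose 2) * x ^ (i + 1)) -
        (x * p ^ N) * (gb p N i * ((-1) ^ i * p ^ (i.choose 2) * x ^ i)) := by
      intro i hi
      have hi' : i ≤ N := by simpa [Nat.lt_succ_iff] using hi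
      have h1 : p ^ N = p ^ (N - i) * p ^ i := by rw [← pow_add]; congr 1; omega
      have h2 : (i + 1).choose 2 = i + i.choose 2 := by
        rw [Nat.choose_succ_succ' i 1]; simp
      rw [gb_succ, h1, h2, pow_add p i]
      ring
    rw [Finset.sum_congr rfl e1, Finset.sum_sub_distrib, ← Finset.mul_sum]
    have e2 := Finset.sum_range_succ' (fun i => gb p N i * ((-1) ^ i * p ^ (i.choose 2) * x ^ i)) (N + 1)
    rw [Finset.sum_range_succ, gb_of_lt p N (N + 1) (by omega)] at e2
    simp only [gb_zero] at e2 ⊢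
    linear_combination e2

lemma summable_quad {q : ℂ} (hq0 : q ≠ 0) (hq : ‖q‖ < 1) (A B : ℤ) (hA : 1 ≤ A) :
    Summable (fun n : ℤ => ‖q ^ (A * n ^ 2 + B * n)‖) := by
  have hr0 : 0 < ‖q‖ := norm_pos_iff.mpr hq0
  have hs : Summable (fun n : ℤ => ‖q‖ ^ n.natAbs) := by
    apply Summable.of_nat_of_neg <;> simpa using summable_geometric_of_lt_one hr0.le hq
  refine Summable.of_nonneg_of_le (fun _ => norm_nonneg _) (fun n => ?_)
    (hs.mul_left (‖q‖ ^ (-(|B| + 1) ^ 2 : ℤ)))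
  rw [norm_zpow, ← zpow_natCast, ← zpow_add₀ hr0.ne']
  apply zpow_le_zpow_right_of_le_one₀ hr0 hq.le
  rw [Int.natCast_natAbs]
  have h1 : -(|B| * |n|) ≤ B * n := by rw [← abs_mul]; exact neg_abs_le _
  have h2 : n ^ 2 = |n| ^ 2 := (sq_abs n).symm
  have h3 : n ^ 2 ≤ A * n ^ 2 := by nlinarith [sq_nonneg n]
  nlinarith [sq_nonneg (|n| - (|B| + 1)), sq_nonneg |n|, sq_nonneg (|B| + 1), sq_nonneg (2 * |n| - (|B| + 1)), abs_nonneg n, abs_nonneg B]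

/-- the theta term -/
noncomputable def tt (q : ℂ) (a : ℤ) (j : ℤ) : ℂ := (-1) ^ j * q ^ (5 * j ^ 2 + (a - 5) * j)

noncomputable def th (q : ℂ) (a : ℤ) : ℂ := ∑' j : ℤ, tt q a j

lemma norm_tt (q : ℂ) (a j : ℤ) : ‖tt q a j‖ = ‖q ^ (5 * j ^ 2 + (a - 5) * j)‖ := by
  rw [tt, norm_mul, norm_zpow]; simp

lemma summable_tt {q : ℂ} (hq0 : q ≠ 0) (hq : ‖q‖ < 1) (a : ℤ) :
    Summable (fun j => ‖tt q a j‖) := by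
  simp only [norm_tt]; exact summable_quad hq0 hq 5 (a - 5) (by norm_num)

noncomputable def al (q : ℂ) (x : ℤ) : ℂ := ∑' j : ℤ, q ^ (10 * j ^ 2 + (2 * x - 10) * j)
noncomputable def be (q : ℂ) (x : ℤ) : ℂ := ∑' j : ℤ, q ^ (10 * j ^ 2 + (2 * x) * j)

lemma finite_triple {q : ℂ} (hq0 : q ≠ 0) (a b : ℕ) (hab : a + b = 10) (n : ℕ) :
    (∏ k ∈ Finset.range n, (1 - q ^ a * (q ^ 10) ^ k)) *
      (∏ k ∈ Finset.range n, (1 - q ^ b * (q ^ 10) ^ k)) =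
    ∑ i ∈ Finset.range (2 * n + 1), gb (q ^ 10) (2 * n) i * tt q a ((i : ℤ) - n) := by
  have h := qbin (q ^ 10) (q ^ ((a : ℤ) - 10 * n)) (2 * n)
  have hb : (b : ℤ) = 10 - a := by omega
  have hc : ∏ k ∈ Finset.range n, (-(q ^ ((a : ℤ) - 10 - 10 * k))) =
      (-1) ^ n * q ^ ((a : ℤ) * n - 5 * n ^ 2 - 5 * n) := by
    clear h
    induction n with
    | zero => simp
    | succ n ih =>
      rw [Finset.prod_range_succ, ih, mul_neg, mul_assoc, ← zpow_add₀ hq0, pow_succ (-1 : ℂ) n]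
      push_cast
      rw [show (a : ℤ) * n - 5 * n ^ 2 - 5 * n + (a - 10 - 10 * n) =
        a * (n + 1) - 5 * (n + 1) ^ 2 - 5 * (n + 1) by ring]
      ring
  have hne : ((-1) ^ n * q ^ ((a : ℤ) * n - 5 * n ^ 2 - 5 * n) : ℂ) ≠ 0 :=
    mul_ne_zero (pow_ne_zero _ (by norm_num)) (zpow_ne_zero _ hq0)
  apply mul_left_cancel₀ hne
  rw [two_mul, Finset.prod_range_add, ← two_mul] at h
  have h1 : ∏ k ∈ Finset.range n, (1 - q ^ ((a : ℤ) - 10 * n) * (q ^ 10) ^ (n + k)) =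
      ∏ k ∈ Finset.range n, (1 - q ^ a * (q ^ 10) ^ k) := by
    refine Finset.prod_congr rfl fun k _ => ?_
    rw [← pow_mul, ← pow_mul, ← zpow_natCast q (10 * (n + k)), ← zpow_add₀ hq0, ← pow_add,
      ← zpow_natCast q (a + _)]
    congr 2; push_cast; ring
  have h2 : ∏ k ∈ Finset.range n, (1 - q ^ ((a : ℤ) - 10 * n) * (q ^ 10) ^ k) =
      (∏ k ∈ Finset.range n, (-(q ^ ((a : ℤ) - 10 - 10 * k)))) *
      ∏ k ∈ Finset.range n, (1 - q ^ b * (q ^ 10) ^ k) := by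
    rw [← Finset.prod_mul_distrib, ← Finset.prod_range_reflect]
    refine Finset.prod_congr rfl fun k hk => ?_
    have hk' := Finset.mem_range.mp hk
    have e : ((n - 1 - k : ℕ) : ℤ) = n - 1 - k := by omega
    rw [← pow_mul, ← pow_mul, ← pow_add, ← zpow_natCast q (10 * _), ← zpow_natCast q (b + _),
      ← zpow_add₀ hq0]
    push_cast
    rw [e, hb, neg_mul, mul_sub (q ^ _), ← zpow_add₀ hq0]
    rw [show ((a : ℤ) - 10 - 10 * k + (10 - a + 10 * k)) = 0 by ring]
    rw [show (a : ℤ) - 10 * n + 10 * (n - 1 - k) = a - 10 - 10 * k by ring]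
    simp
  rw [h1, h2, hc] at h
  rw [show ∀ u v w : ℂ, u * (v * w) = u * w * v by intros; ring, h, Finset.mul_sum]
  refine Finset.sum_congr rfl fun i _ => ?_
  have hch : ((10 * i.choose 2 : ℕ) : ℤ) = 5 * i * (i - 1) := by
    clear * -
    induction i with
    | zero => simp
    | succ i ih =>
      rw [Nat.choose_succ_succ' i 1]
      push_cast at ih ⊢
      simp only [Nat.choose_one_right]
      linear_combination ih
  rw [tt, ← pow_mul, ← zpow_natCast q (10 * _), hch, ← zpow_natCast (q ^ _) i, ← zpow_mul]
  have hs : ((-1 : ℂ)) ^ ((i : ℤ) - n) = (-1) ^ i * (-1) ^ n := by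
    rw [zpow_sub₀ (by norm_num), zpow_natCast, zpow_natCast, div_eq_mul_inv, ← inv_pow]; norm_num
  have hs2 : ((-1 : ℂ)) ^ n * (-1) ^ n = 1 := by rw [← mul_pow]; norm_num
  have hz : q ^ (5 * (i : ℤ) * (i - 1)) * q ^ (((a : ℤ) - 10 * n) * i) =
      q ^ ((a : ℤ) * n - 5 * n ^ 2 - 5 * n) * q ^ (5 * ((i : ℤ) - n) ^ 2 + (a - 5) * ((i : ℤ) - n)) := by
    rw [← zpow_add₀ hq0, ← zpow_add₀ hq0]; congr 1; ring
  rw [hs]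
  linear_combination gb (q ^ 10) (2 * n) i * (-1) ^ i * hz - gb (q ^ 10) (2 * n) i * (-1) ^ i * 
    q ^ ((a : ℤ) * n - 5 * n ^ 2 - 5 * n) * q ^ (5 * ((i : ℤ) - n) ^ 2 + (a - 5) * ((i : ℤ) - n)) * hs2

lemma summable_poch {q : ℂ} (hq : ‖q‖ < 1) (a : ℕ) :
    Summable (fun k : ℕ => ‖-(q ^ a * (q ^ 10) ^ k)‖) := by
  simp only [norm_neg, norm_mul, norm_pow]
  refine (summable_geometric_of_lt_one (by positivity) ?_).mul_left _
  exact pow_lt_one₀ (norm_nonneg _) hq (by norm_num)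

lemma poch_tendsto {q : ℂ} (hq : ‖q‖ < 1) (a : ℕ) :
    Tendsto (fun n => ∏ k ∈ Finset.range n, (1 - q ^ a * (q ^ 10) ^ k)) atTop
      (𝓝 (qPoch (q ^ a) (q ^ 10))) := by
  have h := (multipliable_one_add_of_summable (summable_poch hq a)).tendsto_prod_tprod_nat
  simpa only [qPoch, ← sub_eq_add_neg] using h

lemma one_sub_ne {q : ℂ} (hq : ‖q‖ < 1) (m : ℕ) (hm : m ≠ 0) : 1 - q ^ m ≠ 0 := by
  intro h
  have h1 : q ^ m = 1 := (sub_eq_zero.mp h).symm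
  have h2 : ‖q‖ ^ m < 1 := pow_lt_one₀ (norm_nonneg _) hq hm
  rw [← norm_pow, h1] at h2
  simp at h2

lemma poch_ne {q : ℂ} (hq : ‖q‖ < 1) (a : ℕ) (ha : a ≠ 0) : qPoch (q ^ a) (q ^ 10) ≠ 0 := by
  have h := tprod_one_add_ne_zero_of_summable (f := fun k : ℕ => -(q ^ a * (q ^ 10) ^ k))
    (fun k => by
      rw [← sub_eq_add_neg, ← pow_mul, ← pow_add]; exact one_sub_ne hq _ (by omega))
    (summable_poch hq a)
  simpa only [qPoch, ← sub_eq_add_neg] using h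

lemma fp_ne {q : ℂ} (hq : ‖q‖ < 1) (n : ℕ) : fp (q ^ 10) n ≠ 0 := by
  rw [fp, Finset.prod_ne_zero_iff]
  intro k _
  rw [← pow_mul]; exact one_sub_ne hq _ (by omega)

lemma fp_tendsto {q : ℂ} (hq : ‖q‖ < 1) :
    Tendsto (fp (q ^ 10)) atTop (𝓝 (qPoch (q ^ 10) (q ^ 10))) := by
  have h := poch_tendsto hq 10
  refine h.congr fun n => ?_
  rw [fp]; refine Finset.prod_congr rfl fun k _ => ?_
  rw [pow_succ]; ring

lemma triple {q : ℂ} (hq0 : q ≠ 0) (hq : ‖q‖ < 1) (a b : ℕ) (hab : a + b = 10) :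
    th q a = qPoch (q ^ 10) (q ^ 10) * (qPoch (q ^ a) (q ^ 10) * qPoch (q ^ b) (q ^ 10)) := by
  set L := qPoch (q ^ 10) (q ^ 10) with hL
  have hL0 : L ≠ 0 := poch_ne hq 10 (by norm_num)
  have hlim := fp_tendsto hq
  rw [← hL] at hlim
  have hinv := hlim.inv₀ hL0
  obtain ⟨C, hC⟩ := (Metric.isBounded_range_of_tendsto _ hlim).exists_norm_le
  obtain ⟨D, hD⟩ := (Metric.isBounded_range_of_tendsto _ hinv).exists_norm_le
  have hC' : ∀ n, ‖fp (q ^ 10) n‖ ≤ C := fun n => hC _ ⟨n, rfl⟩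
  have hD' : ∀ n, ‖(fp (q ^ 10) n)⁻¹‖ ≤ D := fun n => hD _ ⟨n, rfl⟩
  have hgb : ∀ N i j, i + j = N →
      gb (q ^ 10) N i = fp (q ^ 10) N * ((fp (q ^ 10) i)⁻¹ * (fp (q ^ 10) j)⁻¹) := by
    intro N i j h
    have := gb_mul (q ^ 10) N i j h
    have h1 := fp_ne hq i
    have h2 := fp_ne hq j
    rw [← this]; field_simp
  let g : ℕ → ℤ → ℂ := fun n j =>
    if j ∈ Finset.Icc (-(n : ℤ)) n then gb (q ^ 10) (2 * n) (n + j).toNat * tt q a j else 0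
  have hg : ∀ n, ∑' j, g n j = (∏ k ∈ Finset.range n, (1 - q ^ a * (q ^ 10) ^ k)) *
      (∏ k ∈ Finset.range n, (1 - q ^ b * (q ^ 10) ^ k)) := by
    intro n
    rw [finite_triple hq0 a b hab n, tsum_eq_sum (s := Finset.Icc (-(n : ℤ)) n)]
    · refine Finset.sum_nbij' (fun j => (n + j).toNat) (fun i => (i : ℤ) - n) ?_ ?_ ?_ ?_ ?_
      · intro j hj; simp at hj ⊢; omega
      · intro j hj; simp at hj ⊢; omega
      · intro j hj; simp at hj ⊢; omega
      · intro j hj; simp at hj ⊢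
      · intro j hj
        have : (((n + j).toNat : ℕ) : ℤ) - n = j := by simp at hj ⊢; omega
        simp only [g, hj, if_true, this]
    · intro j hj; simp only [g, hj, if_false]
  have hC0 : 0 ≤ C := (norm_nonneg _).trans (hC' 0)
  have hD0 : 0 ≤ D := (norm_nonneg _).trans (hD' 0)
  have hT : Tendsto (fun n => ∑' j, g n j) atTop (𝓝 (∑' j, L⁻¹ * tt q a j)) := by
    refine tendsto_tsum_of_dominated_convergence
      (bound := fun j => C * (D * D) * ‖tt q a j‖) ((summable_tt hq0 hq a).mul_left _) ?_ ?_
    · intro j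
      have ht1 : Tendsto (fun n : ℕ => 2 * n) atTop atTop :=
        tendsto_atTop_mono (fun n => by simp only [id]; omega) tendsto_id
      have ht2 : Tendsto (fun n : ℕ => ((n : ℤ) + j).toNat) atTop atTop := by
        refine tendsto_atTop.mpr fun b => ?_
        filter_upwards [eventually_ge_atTop (b + j.natAbs)] with n hn
        omega
      have ht3 : Tendsto (fun n : ℕ => ((n : ℤ) - j).toNat) atTop atTop := by
        refine tendsto_atTop.mpr fun b => ?_
        filter_upwards [eventually_ge_atTop (b + j.natAbs)] with n hn
        omega
      have hl := ((hlim.comp ht1).mul ((hinv.comp ht2).mul (hinv.comp ht3))).mul_const (tt q a j)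
      rw [mul_inv_cancel_left₀ hL0] at hl
      refine hl.congr' ?_
      filter_upwards [eventually_ge_atTop j.natAbs] with n hn
      have hm : j ∈ Finset.Icc (-(n : ℤ)) n := by simp; omega
      simp only [g, hm, if_true, Function.comp]
      rw [hgb (2 * n) ((n : ℤ) + j).toNat ((n : ℤ) - j).toNat (by omega)]
    · refine Eventually.of_forall fun n j => ?_
      by_cases hm : j ∈ Finset.Icc (-(n : ℤ)) n
      · simp only [g, hm, if_true]
        simp at hm
        rw [hgb (2 * n) ((n : ℤ) + j).toNat ((n : ℤ) - j).toNat (by omega), norm_mul, norm_mul,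
          norm_mul]
        gcongr
        · exact hC' _
        · exact hD' _
        · exact hD' _
      · simp only [g, hm, if_false, norm_zero]; positivity
  have hP := (poch_tendsto hq a).mul (poch_tendsto hq b)
  have := tendsto_nhds_unique (hT.congr hg) hP
  rw [tsum_mul_left] at this
  rw [← this, th, mul_inv_cancel_left₀ hL0]

/-- Splitting of `ℤ × ℤ` by parity of the sum of coordinates. -/
def parityEquiv : (ℤ × ℤ) ⊕ (ℤ × ℤ) ≃ ℤ × ℤ where
  toFun := Sum.elim (fun z => (z.1 + z.2, z.1 - z.2)) (fun z => (z.1 + z.2 + 1, z.1 - z.2))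
  invFun z := if (z.1 + z.2) % 2 = 0 then Sum.inl ((z.1 + z.2) / 2, (z.1 - z.2) / 2)
    else Sum.inr ((z.1 + z.2) / 2, (z.1 - z.2) / 2)
  left_inv := by
    rintro (⟨j, k⟩ | ⟨j, k⟩)
    · have h : (j + k + (j - k)) % 2 = 0 := by omega
      simp only [Sum.elim_inl, h, if_true, Sum.inl.injEq, Prod.mk.injEq]
      omega
    · have h : ¬ (j + k + 1 + (j - k)) % 2 = 0 := by omega
      simp only [Sum.elim_inr, h, if_false, Sum.inr.injEq, Prod.mk.injEq]
      omega
  right_inv := by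
    rintro ⟨m, n⟩
    by_cases h : (m + n) % 2 = 0
    · simp only [h, if_true, Sum.elim_inl, Prod.mk.injEq]; omega
    · simp only [h, if_false, Sum.elim_inr, Prod.mk.injEq]; omega

lemma al_shift {q : ℂ} (hq0 : q ≠ 0) (y : ℤ) :
    ∑' k : ℤ, q ^ (10 * k ^ 2 + (2 * y + 10) * k) = q ^ (-(2 * y)) * al q y := by
  rw [al, ← tsum_mul_left, ← (Equiv.subRight (1 : ℤ)).tsum_eq]
  refine tsum_congr fun k => ?_
  rw [← zpow_add₀ hq0]
  congr 1
  simp only [Equiv.subRight_apply]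
  ring

lemma th_mul {q : ℂ} (hq0 : q ≠ 0) (hq : ‖q‖ < 1) (x y : ℤ) :
    th q (x + y) * th q (x - y) = al q x * be q y - q ^ (x - y) * (be q x * al q y) := by
  have s1 := summable_tt hq0 hq (x + y)
  have s2 := summable_tt hq0 hq (x - y)
  have hS := summable_mul_of_summable_norm s1 s2
  rw [th, th, tsum_mul_tsum_of_summable_norm s1 s2, ← parityEquiv.tsum_eq]
  have hS' := parityEquiv.summable_iff.mpr hS
  change ∑' c, ((fun z : ℤ × ℤ => tt q (x + y) z.1 * tt q (x - y) z.2) ∘ parityEquiv) c = _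
  rw [Summable.tsum_sum (hS'.comp_injective Sum.inl_injective) (hS'.comp_injective Sum.inr_injective)]
  have A1 := summable_quad hq0 hq 10 (2 * x - 10) (by norm_num)
  have A2 := summable_quad hq0 hq 10 (2 * x) (by norm_num)
  have B1 := summable_quad hq0 hq 10 (2 * y) (by norm_num)
  have B2 := summable_quad hq0 hq 10 (2 * y + 10) (by norm_num)
  have e1 : al q x * be q y = ∑' z : ℤ × ℤ, q ^ (10 * z.1 ^ 2 + (2 * x - 10) * z.1) *
      q ^ (10 * z.2 ^ 2 + (2 * y) * z.2) := tsum_mul_tsum_of_summable_norm A1 B1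
  have e2 : be q x * (∑' k : ℤ, q ^ (10 * k ^ 2 + (2 * y + 10) * k)) =
      ∑' z : ℤ × ℤ, q ^ (10 * z.1 ^ 2 + (2 * x) * z.1) *
      q ^ (10 * z.2 ^ 2 + (2 * y + 10) * z.2) := tsum_mul_tsum_of_summable_norm A2 B2
  have e3 : q ^ (x - y) * (be q x * al q y) =
      q ^ (x + y) * (be q x * (∑' k : ℤ, q ^ (10 * k ^ 2 + (2 * y + 10) * k))) := by
    rw [al_shift hq0, show x - y = x + y + -(2 * y) by ring, zpow_add₀ hq0 (x + y)]; ring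
  rw [e3, e1, e2, sub_eq_add_neg (tsum _), ← tsum_mul_left, ← tsum_neg]
  congr 1
  · refine tsum_congr fun z => ?_
    obtain ⟨j, k⟩ := z
    simp only [Function.comp_apply, parityEquiv, Equiv.coe_fn_mk, Sum.elim_inl, tt]
    have hs : ((-1 : ℂ)) ^ (j + k) * (-1) ^ (j - k) = 1 := by
      rw [← zpow_add₀ (by norm_num), show j + k + (j - k) = 2 * j by ring, zpow_mul]; norm_num
    rw [mul_mul_mul_comm, hs, one_mul, ← zpow_add₀ hq0, ← zpow_add₀ hq0]
    congr 1; ring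
  · refine tsum_congr fun z => ?_
    obtain ⟨j, k⟩ := z
    simp only [Function.comp_apply, parityEquiv, Equiv.coe_fn_mk, Sum.elim_inr, tt]
    have hs : ((-1 : ℂ)) ^ (j + k + 1) * (-1) ^ (j - k) = -1 := by
      rw [← zpow_add₀ (by norm_num), show j + k + 1 + (j - k) = 2 * j + 1 by ring,
        zpow_add₀ (by norm_num), zpow_mul]; norm_num
    rw [mul_mul_mul_comm, hs, neg_one_mul, ← zpow_add₀ hq0, ← zpow_add₀ hq0, ← zpow_add₀ hq0]
    congr 2; ring

lemma th_rel {q : ℂ} (hq0 : q ≠ 0) (hq : ‖q‖ < 1) (x u y : ℤ) :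
    th q (x + y) * th q (x - y) * th q u ^ 2 - th q x ^ 2 * (th q (u + y) * th q (u - y)) =
      q ^ (u - y) * (th q (x + u) * th q (x - u) * th q y ^ 2) := by
  have hx := th_mul hq0 hq x 0
  have hu := th_mul hq0 hq u 0
  have hy := th_mul hq0 hq y 0
  simp only [add_zero, sub_zero, ← sq] at hx hu hy
  rw [th_mul hq0 hq x y, th_mul hq0 hq u y, th_mul hq0 hq x u, hx, hu, hy]
  simp only [zpow_sub₀ hq0]
  have h1 := zpow_ne_zero x hq0
  have h2 := zpow_ne_zero u hq0
  have h3 := zpow_ne_zero y hq0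
  field_simp
  ring

lemma final_alg {q c1 c2 c3 c4 c5 i j e f : ℂ} (h1 : c1 ≠ 0) (h2 : c2 ≠ 0) (h3 : c3 ≠ 0)
    (h4 : c4 ≠ 0) (he : e ≠ 0) (hq : q = e ^ 4) (hf : f = e ^ 3)
    (r1 : c2 ^ 3 * c4 = c1 * c3 ^ 3 + q * c1 ^ 3 * c5)
    (r2 : c2 * c3 ^ 2 * c4 = c1 * c4 ^ 2 * c5 + q * c1 * c2 ^ 2 * c3)
    (hi : i = f * c1 / c4) (hj : j = e * c2 / c3) :
    i ^ 4 + 1 / j ^ 4 = 1 / (i / j) ^ 2 - 2 + 3 * (i / j) ^ 2 ∧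
    j ^ 4 + 1 / i ^ 4 = 1 / (i / j) ^ 6 - 2 / (i / j) ^ 4 + 3 / (i / j) ^ 2 := by
  have key : c2 ^ 3 * c4 ^ 3 = q * c1 ^ 2 * c2 * c3 ^ 2 * c4 - q ^ 2 * c1 ^ 3 * c2 ^ 2 * c3
      + c1 * c3 ^ 3 * c4 ^ 2 := by
    linear_combination c4 ^ 2 * r1 - q * c1 ^ 2 * r2
  have hi0 : i ≠ 0 := by rw [hi, hf]; positivity
  have hj0 : j ≠ 0 := by rw [hj]; positivity
  have k2 : j ^ 3 = i ^ 2 * j - i ^ 3 * j ^ 2 + i := by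
    rw [hi, hj, hf]
    rw [hq] at key
    field_simp
    linear_combination key
  have k3 : (j ^ 3 - i ^ 2 * j) ^ 2 = (i - i ^ 3 * j ^ 2) ^ 2 := by
    rw [k2]; ring
  constructor
  · field_simp
    linear_combination -k3
  · field_simp
    linear_combination -k3

end TriProd

open TriProd in
theorem statement9 (τ : UpperHalfPlane) :
    Ifun τ ^ 4 + 1 / Jfun τ ^ 4 = 1 / UIJ τ ^ 2 - 2 + 3 * UIJ τ ^ 2 ∧
    Jfun τ ^ 4 + 1 / Ifun τ ^ 4 = 1 / UIJ τ ^ 6 - 2 / UIJ τ ^ 4 + 3 / UIJ τ ^ 2 := by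
  have hq0 : Qc τ ≠ 0 := Complex.exp_ne_zero _
  have hq : ‖Qc τ‖ < 1 := UpperHalfPlane.norm_exp_two_pi_I_lt_one τ
  have hqe : Qc τ = Complex.exp (2 * Real.pi * Complex.I * τ * (1 / 4)) ^ 4 := by
    rw [Qc, ← Complex.exp_nat_mul]; congr 1; push_cast; ring
  have hfe : Complex.exp (2 * Real.pi * Complex.I * τ * (3 / 4)) =
      Complex.exp (2 * Real.pi * Complex.I * τ * (1 / 4)) ^ 3 := by
    rw [← Complex.exp_nat_mul]; congr 1; push_cast; ring
  have hI := Ifun.eq_1 τ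
  have hJ := Jfun.eq_1 τ
  unfold UIJ
  generalize Ifun τ = i at *
  generalize Jfun τ = j at *
  generalize Qc τ = q at *
  have hL0 : qPoch (q ^ 10) (q ^ 10) ≠ 0 := poch_ne hq 10 (by norm_num)
  have n := fun a ha => poch_ne hq a ha
  have t1 := triple hq0 hq 1 9 rfl
  have t2 := triple hq0 hq 2 8 rfl
  have t3 := triple hq0 hq 3 7 rfl
  have t4 := triple hq0 hq 4 6 rfl
  have t5 := triple hq0 hq 5 5 rfl
  have t6 := triple hq0 hq 6 4 rfl
  have t7 := triple hq0 hq 7 3 rfl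
  have r1 := th_rel hq0 hq 3 2 1
  have r2 := th_rel hq0 hq 4 3 2
  norm_num at t1 t2 t3 t4 t5 t6 t7 r1 r2
  rw [t1, t2, t3, t4, t5] at r1
  rw [t1, t2, t3, t4, t5, t6, t7] at r2
  refine final_alg (c1 := qPoch q (q ^ 10) * qPoch (q ^ 9) (q ^ 10))
    (c2 := qPoch (q ^ 2) (q ^ 10) * qPoch (q ^ 8) (q ^ 10))
    (c3 := qPoch (q ^ 3) (q ^ 10) * qPoch (q ^ 7) (q ^ 10))
    (c4 := qPoch (q ^ 4) (q ^ 10) * qPoch (q ^ 6) (q ^ 10))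
    (c5 := qPoch (q ^ 5) (q ^ 10) * qPoch (q ^ 5) (q ^ 10))
    (mul_ne_zero (by simpa using n 1 (by norm_num)) (n 9 (by norm_num)))
    (mul_ne_zero (n 2 (by norm_num)) (n 8 (by norm_num)))
    (mul_ne_zero (n 3 (by norm_num)) (n 7 (by norm_num)))
    (mul_ne_zero (n 4 (by norm_num)) (n 6 (by norm_num)))
    (Complex.exp_ne_zero _) hqe hfe ?_ ?_ hI hJ
  · apply mul_left_cancel₀ (pow_ne_zero 4 hL0)
    linear_combination r1
  · apply mul_left_cancel₀ (pow_ne_zero 4 hL0)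
    linear_combination r2
end
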